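/- arXiv:1709.03498 — 3 statements merged into one kernel-verified Lean document; each statement's English description precedes it below -/
import Mathlib

section
/- For every real parameter a with -1 < a ≤ 2, the dimensionless energy-to-pressure ratio r(γ, a) tends to 3 as γ → 0⁺; that is, lim_{γ→0⁺} (∫_γ^∞ (K₃(s) − K₂(s)/s)(s − γ)^a ds) / (∫_γ^∞ (K₂(s)/s)(s − γ)^a ds) = 3. -/
open MeasureTheory Real Filter Set

/-- Modified Bessel function of the second kind, integral representation. -/
noncomputable def besselK (n : ℕ) (x : ℝ) : ℝ :=
  ∫ t in Set.Ioi (0 : ℝ), Real.exp (-x * Real.cosh t) * Real.cosh (n * t)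

/-- Dimensionless energy-to-pressure ratio `r(γ, a) = e/p` of a relativistic
gas with internal structure, state-density measure `φ(I) = I^a`. -/
noncomputable def rRatio (γ a : ℝ) : ℝ :=
  (∫ s in Set.Ioi γ, (besselK 3 s - besselK 2 s / s) * (s - γ) ^ a) /
  (∫ s in Set.Ioi γ, (besselK 2 s / s) * (s - γ) ^ a)

lemma bk_pt (n : ℕ) (s t : ℝ) (hs : 0 < s) (ht : 0 < t) :
    Real.exp (-s * Real.cosh t) * Real.cosh (n * t) ≤
      ((n+1).factorial * 4^(n+1) / s^(n+1) * Real.exp (-s/2)) * Real.exp (-t) := by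
  have h1 : Real.exp t ≤ 2 * Real.cosh t := by
    rw [Real.cosh_eq]; have := Real.exp_pos (-t); linarith
  have h2 : Real.cosh (n*t) ≤ Real.exp (n * t) := by
    rw [Real.cosh_eq]
    have : Real.exp (-(n*t)) ≤ Real.exp (n*t) := by
      apply Real.exp_le_exp.2
      have : 0 ≤ (n:ℝ)*t := by positivity
      linarith
    linarith
  have h3 : Real.exp (-s * Real.cosh t) ≤ Real.exp (-s/2) * Real.exp (-(s * Real.exp t / 4)) := by
    rw [← Real.exp_add]
    apply Real.exp_le_exp.2
    have := Real.one_le_cosh t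
    nlinarith
  have h4 : Real.exp (-(s * Real.exp t / 4)) ≤
      (n+1).factorial * 4^(n+1) / s^(n+1) * Real.exp (-((n+1) * t)) := by
    have hy : 0 < s * Real.exp t / 4 := by positivity
    have h5 := Real.pow_div_factorial_le_exp _ hy.le (n+1)
    rw [Real.exp_neg, Real.exp_neg]
    have h6 : Real.exp ((n+1)*t) = Real.exp t ^ (n+1) := by
      rw [← Real.exp_nat_mul]; push_cast; rfl
    rw [h6]
    have h7 : ((n+1).factorial * 4^(n+1) / s^(n+1) * (Real.exp t ^ (n+1))⁻¹ : ℝ)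
        = ((s * Real.exp t / 4)^(n+1) / (n+1).factorial)⁻¹ := by
      rw [div_pow, mul_pow]; field_simp
    rw [h7]
    exact inv_anti₀ (by positivity) h5
  have h8 : Real.exp (-((n+1) * t)) * Real.exp (n*t) = Real.exp (-t) := by
    rw [← Real.exp_add]; congr 1; ring
  calc _ ≤ (Real.exp (-s/2) * ((n+1).factorial * 4^(n+1) / s^(n+1) * Real.exp (-((n+1) * t))))
          * Real.exp (n*t) := by
        apply mul_le_mul _ h2 (by positivity) (by positivity)
        exact h3.trans (by gcongr)
    _ = _ := by rw [← h8]; ring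

lemma bk_int (n : ℕ) (s : ℝ) (hs : 0 < s) :
    IntegrableOn (fun t => Real.exp (-s * Real.cosh t) * Real.cosh (n * t)) (Ioi (0:ℝ)) := by
  have h := (integrableOn_exp_neg_Ioi (0:ℝ)).const_mul
    ((n+1).factorial * 4^(n+1) / s^(n+1) * Real.exp (-s/2))
  refine Integrable.mono' h (by fun_prop) ?_
  filter_upwards [ae_restrict_mem measurableSet_Ioi] with t ht
  rw [Real.norm_of_nonneg (by positivity)]
  exact bk_pt n s t hs ht

lemma bk_upper (n : ℕ) : ∃ C : ℝ, 0 < C ∧ ∀ s : ℝ, 0 < s →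
    besselK n s ≤ C / s^(n+1) * Real.exp (-s/2) := by
  refine ⟨(n+1).factorial * 4^(n+1), by positivity, fun s hs => ?_⟩
  have h := (integrableOn_exp_neg_Ioi (0:ℝ)).const_mul
    ((n+1).factorial * 4^(n+1) / s^(n+1) * Real.exp (-s/2))
  have := setIntegral_mono_on (bk_int n s hs) h measurableSet_Ioi
    (fun t ht => bk_pt n s t hs ht)
  rw [integral_const_mul, integral_exp_neg_Ioi_zero, mul_one] at this
  exact this

lemma bk_nonneg (n : ℕ) (s : ℝ) : 0 ≤ besselK n s :=
  integral_nonneg (fun t => by positivity)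

lemma bk_meas (n : ℕ) : Measurable (besselK n) := by
  have : StronglyMeasurable (Function.uncurry fun (s t : ℝ) =>
      Real.exp (-s * Real.cosh t) * Real.cosh (n * t)) := by
    apply Continuous.stronglyMeasurable
    unfold Function.uncurry
    fun_prop
  exact (this.integral_prod_right (ν := volume.restrict (Ioi (0:ℝ)))).measurable

lemma bk2_lower : ∃ c : ℝ, 0 < c ∧ ∀ s : ℝ, 0 < s → s ≤ 1 → c / s^2 ≤ besselK 2 s := by
  refine ⟨Real.exp (-Real.exp 1) / 2, by positivity, fun s hs hs1 => ?_⟩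
  set L := Real.log (1/s) with hL
  have hL0 : 0 ≤ L := Real.log_nonneg (by rw [le_div_iff₀ hs]; linarith)
  have heL : Real.exp L = 1/s := Real.exp_log (by positivity)
  have hsub : Ioc L (L+1) ⊆ Ioi (0:ℝ) := fun t ht => lt_of_le_of_lt hL0 ht.1
  have hi := bk_int 2 s hs
  have h1 : ∫ t in Ioc L (L+1), Real.exp (-s * Real.cosh t) * Real.cosh ((2:ℕ) * t)
      ≤ besselK 2 s :=
    setIntegral_mono_set hi (Eventually.of_forall fun t => by positivity)
      (LE.le.eventuallyLE hsub)
  have h2 : ∫ t in Ioc L (L+1), (Real.exp (-Real.exp 1) / 2 / s^2) ≤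
      ∫ t in Ioc L (L+1), Real.exp (-s * Real.cosh t) * Real.cosh ((2:ℕ) * t) := by
    refine setIntegral_mono_on (by simp) (hi.mono_set hsub) measurableSet_Ioc ?_
    intro t ht
    have ht0 : 0 < t := hsub ht
    have a1 : Real.cosh t ≤ Real.exp 1 / s := by
      have b1 : Real.cosh t ≤ Real.exp t := by
        rw [Real.cosh_eq]
        have : Real.exp (-t) ≤ Real.exp t := Real.exp_le_exp.2 (by linarith)
        linarith
      have b2 : Real.exp t ≤ Real.exp (L+1) := Real.exp_le_exp.2 ht.2
      rw [Real.exp_add, heL] at b2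
      calc _ ≤ _ := b1.trans b2
        _ = _ := by ring
    have a2 : Real.exp (-Real.exp 1) ≤ Real.exp (-s * Real.cosh t) := by
      apply Real.exp_le_exp.2
      rw [le_div_iff₀ hs] at a1
      linarith
    have a3 : 1 / s^2 / 2 ≤ Real.cosh ((2:ℕ)*t) := by
      have b1 : Real.exp L ≤ Real.exp t := Real.exp_le_exp.2 ht.1.le
      rw [heL] at b1
      have b2 : Real.exp ((2:ℕ)*t) = Real.exp t ^ 2 := Real.exp_nat_mul _ _
      have b3 : (1/s)^2 ≤ Real.exp t ^2 := by gcongr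
      rw [Real.cosh_eq, b2]
      have := Real.exp_pos (-((2:ℕ)*t))
      rw [div_pow, one_pow] at b3
      have b4 : 0 ≤ Real.exp (-((2:ℕ)*t)) / 2 := by positivity
      rw [add_div]
      exact le_add_of_le_of_nonneg (div_le_div_of_nonneg_right b3 (by norm_num)) b4
    calc _ = Real.exp (-Real.exp 1) * (1/s^2/2) := by ring
      _ ≤ _ := by gcongr
  have h3 : ∫ t in Ioc L (L+1), (Real.exp (-Real.exp 1) / 2 / s^2)
      = Real.exp (-Real.exp 1) / 2 / s^2 := by simp
  exact h3.symm.le.trans (h2.trans h1)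

lemma bk_rec (s : ℝ) (hs : 0 < s) : besselK 3 s - besselK 2 s / s
    = besselK 1 s + 3 * (besselK 2 s / s) := by
  have i1 := bk_int 1 s hs
  have i2 := bk_int 2 s hs
  have i3 := bk_int 3 s hs
  set F : ℝ → ℝ := fun t => -(2/s) * (Real.exp (-s * Real.cosh t) * Real.sinh (2*t))
  set F' : ℝ → ℝ := fun t =>
    (Real.exp (-s * Real.cosh t) * Real.cosh ((3:ℕ) * t)
      - Real.exp (-s * Real.cosh t) * Real.cosh ((1:ℕ) * t))
      - (4/s) * (Real.exp (-s * Real.cosh t) * Real.cosh ((2:ℕ) * t))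
  have iF' : IntegrableOn F' (Ioi 0) := (i3.sub i1).sub (i2.const_mul _)
  have iF : IntegrableOn F (Ioi 0) := by
    apply Integrable.const_mul
    refine Integrable.mono i2 (by fun_prop) (Eventually.of_forall fun t => ?_)
    rw [norm_mul, norm_mul]
    apply mul_le_mul_of_nonneg_left _ (norm_nonneg _)
    rw [Real.norm_eq_abs, Real.norm_eq_abs, abs_of_pos (Real.cosh_pos _)]
    push_cast
    rw [abs_le]
    constructor
    · rw [Real.cosh_eq, Real.sinh_eq]; have := Real.exp_pos (2*t); linarith
    · exact (Real.sinh_lt_cosh _).le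
  have hd : ∀ t ∈ Ici (0:ℝ), HasDerivAt F (F' t) t := by
    intro t _
    have d1 : HasDerivAt (fun t => Real.exp (-s * Real.cosh t))
      (Real.exp (-s * Real.cosh t) * (-s * Real.sinh t)) t :=
      ((Real.hasDerivAt_cosh t).const_mul (-s)).exp
    have d2 : HasDerivAt (fun t => Real.sinh (2*t)) (Real.cosh (2*t) * (2*1)) t :=
      ((hasDerivAt_id t).const_mul 2).sinh
    refine HasDerivAt.congr_deriv (f := F) ((d1.mul d2).const_mul (-(2/s))) ?_
    symm
    show _ - _ - _ = _
    have e3 : Real.cosh ((3:ℕ)*t) = Real.cosh (2*t) * Real.cosh t + Real.sinh (2*t) * Real.sinh t := by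
      rw [← Real.cosh_add]; congr 1; push_cast; ring
    have e1 : Real.cosh ((1:ℕ)*t) = Real.cosh (2*t) * Real.cosh t - Real.sinh (2*t) * Real.sinh t := by
      rw [← Real.cosh_sub]; congr 1; push_cast; ring
    rw [e3, e1]
    push_cast
    field_simp
    ring
  have ht := tendsto_zero_of_hasDerivAt_of_integrableOn_Ioi (fun t ht => hd t (Ioi_subset_Ici_self ht)) iF' iF
  have hI := integral_Ioi_of_hasDerivAt_of_tendsto' hd iF' ht
  have hF0 : F 0 = 0 := by simp [F]
  rw [hF0, sub_zero] at hI
  have : ∫ t in Ioi (0:ℝ), F' t = (besselK 3 s - besselK 1 s) - (4/s) * besselK 2 s := by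
    simp only [F']
    rw [integral_sub, integral_sub i3 i1, integral_const_mul]
    · rfl
    · exact i3.sub i1
    · exact i2.const_mul _
  rw [this] at hI
  have : (4/s) * besselK 2 s = 4 * (besselK 2 s / s) := by ring
  linarith

lemma g_shift (a : ℝ) (ha : -1 < a) : ∃ M : ℝ, 0 ≤ M ∧ ∀ γ : ℝ, 0 < γ →
    IntegrableOn (fun s => Real.exp (-s/2) * (s-γ)^a) (Ioi γ) ∧
    ∫ s in Ioi γ, Real.exp (-s/2) * (s-γ)^a ≤ M := by
  set g : ℝ → ℝ := fun u => Real.exp (-u/2) * u^a with hg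
  have ig : IntegrableOn g (Ioi 0) := by
    have := integrableOn_rpow_mul_exp_neg_mul_rpow (p := 1) (s := a) (b := 1/2) ha one_pos (by norm_num)
    refine this.congr_fun (fun x _ => ?_) measurableSet_Ioi
    simp only [hg, Real.rpow_one]
    rw [mul_comm]; congr 2; ring
  refine ⟨∫ u in Ioi (0:ℝ), g u, setIntegral_nonneg measurableSet_Ioi
    (fun u hu => by have : 0 < u := hu; positivity), fun γ hγ => ?_⟩
  have hind : (Ioi γ).indicator (fun s => g (s-γ)) = fun s => (Ioi (0:ℝ)).indicator g (s-γ) := by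
    ext s
    by_cases h : γ < s
    · rw [indicator_of_mem (show s ∈ Ioi γ from h), indicator_of_mem (show s - γ ∈ Ioi (0:ℝ) from sub_pos.2 h)]
    · rw [indicator_of_notMem (show s ∉ Ioi γ from h), indicator_of_notMem (show s - γ ∉ Ioi (0:ℝ) from fun h' => h (sub_pos.1 h'))]
  have is : IntegrableOn (fun s => g (s-γ)) (Ioi γ) := by
    rw [← integrable_indicator_iff measurableSet_Ioi, hind]
    exact ((integrable_indicator_iff measurableSet_Ioi).2 ig).comp_sub_right γ
  have es : ∫ s in Ioi γ, g (s-γ) = ∫ u in Ioi (0:ℝ), g u := by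
    rw [← integral_indicator measurableSet_Ioi, hind, integral_sub_right_eq_self (fun s => (Ioi (0:ℝ)).indicator g s) γ,
      integral_indicator measurableSet_Ioi]
  have hle : ∀ s ∈ Ioi γ, Real.exp (-s/2) * (s-γ)^a ≤ g (s-γ) := by
    intro s hs
    have : 0 < s - γ := sub_pos.2 hs
    simp only [hg]
    gcongr
    linarith
  have i0 : IntegrableOn (fun s => Real.exp (-s/2) * (s-γ)^a) (Ioi γ) := by
    refine Integrable.mono' is (Measurable.aestronglyMeasurable (by fun_prop)) ?_
    filter_upwards [ae_restrict_mem measurableSet_Ioi] with s hs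
    have : 0 < s - γ := sub_pos.2 hs
    rw [Real.norm_of_nonneg (by positivity)]
    exact hle s hs
  exact ⟨i0, es ▸ setIntegral_mono_on i0 is measurableSet_Ioi hle⟩

lemma bk_intOn (n : ℕ) (a : ℝ) (ha : -1 < a) (γ : ℝ) (hγ : 0 < γ) :
    IntegrableOn (fun s => besselK n s * (s-γ)^a) (Ioi γ) := by
  obtain ⟨M, -, hM⟩ := g_shift a ha
  obtain ⟨C, hC, hK⟩ := bk_upper n
  refine Integrable.mono' ((hM γ hγ).1.const_mul (C / γ^(n+1)))
    (((bk_meas n).mul (by fun_prop)).aestronglyMeasurable) ?_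
  filter_upwards [ae_restrict_mem measurableSet_Ioi] with s hs
  have hs' : γ < s := hs
  have : 0 < s - γ := sub_pos.2 hs
  have hs0 : 0 < s := hγ.trans hs'
  have h0 := bk_nonneg n s
  rw [Real.norm_of_nonneg (by positivity), ← mul_assoc]
  gcongr
  refine (hK s hs0).trans ?_
  gcongr

lemma bk_intOn' (n : ℕ) (a : ℝ) (ha : -1 < a) (γ : ℝ) (hγ : 0 < γ) :
    IntegrableOn (fun s => besselK n s / s * (s-γ)^a) (Ioi γ) := by
  refine Integrable.mono' ((bk_intOn n a ha γ hγ).const_mul (1/γ))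
    ((((bk_meas n).div measurable_id).mul (by fun_prop)).aestronglyMeasurable) ?_
  filter_upwards [ae_restrict_mem measurableSet_Ioi] with s hs
  have hs' : γ < s := hs
  have : 0 < s - γ := sub_pos.2 hs
  have hs0 : 0 < s := hγ.trans hs'
  have h0 := bk_nonneg n s
  rw [Real.norm_of_nonneg (by positivity), ← mul_assoc]
  gcongr
  rw [div_eq_mul_inv, mul_comm, one_div]
  gcongr

lemma den_lower (a : ℝ) (ha : -1 < a) (ha2 : a ≤ 2) : ∃ c : ℝ, 0 < c ∧ ∀ γ : ℝ, 0 < γ → 2 * γ ≤ 1 →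
    c * Real.log (1 / (2*γ)) ≤ ∫ s in Ioi γ, besselK 2 s / s * (s-γ)^a := by
  obtain ⟨c, hc, hK⟩ := bk2_lower
  refine ⟨c/4, by positivity, fun γ hγ h1 => ?_⟩
  have hsub : Ioc (2*γ) 1 ⊆ Ioi γ := fun s hs => by
    have := hs.1
    show γ < s
    linarith
  have hi := bk_intOn' 2 a ha γ hγ
  have e : ∫ s in Ioc (2*γ) 1, (c/4) * (1/s) = c/4 * Real.log (1 / (2*γ)) := by
    rw [integral_const_mul, ← intervalIntegral.integral_of_le h1, integral_one_div_of_pos (by positivity) one_pos]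
  have ii : IntegrableOn (fun s : ℝ => (c/4) * (1/s)) (Ioc (2*γ) 1) := by
    apply Integrable.const_mul
    have : IntervalIntegrable (fun s:ℝ => 1/s) volume (2*γ) 1 := by
      apply intervalIntegral.intervalIntegrable_one_div
      · intro x hx
        rw [uIcc_of_le h1] at hx
        have := hx.1
        linarith
      · fun_prop
    exact (intervalIntegrable_iff_integrableOn_Ioc_of_le h1).1 this
  rw [← e]
  refine (setIntegral_mono_on ii (hi.mono_set hsub) measurableSet_Ioc ?_).trans
    (setIntegral_mono_set hi ?_ (LE.le.eventuallyLE hsub))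
  · intro s hs
    have hs1 : 2*γ < s := hs.1
    have hs2 : s ≤ 1 := hs.2
    have hs0 : 0 < s := by linarith
    have p : 0 < s - γ := by linarith
    have q : (s/2)^2 ≤ (s-γ)^a := by
      calc (s/2)^2 ≤ (s-γ)^2 := by gcongr; linarith
        _ = (s-γ)^(2:ℝ) := by norm_num
        _ ≤ _ := Real.rpow_le_rpow_of_exponent_ge p (by linarith) ha2
    calc _ = c / s^2 / s * (s/2)^2 := by field_simp; norm_num
      _ ≤ _ := by
        have := hK s hs0 hs2
        have := bk_nonneg 2 s
        gcongr
  · filter_upwards [ae_restrict_mem measurableSet_Ioi] with s hs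
    have hs' : γ < s := hs
    have : 0 < s - γ := sub_pos.2 hs
    have hs0 : 0 < s := hγ.trans hs'
    have h0 := bk_nonneg 2 s
    show 0 ≤ _
    positivity

lemma den_tendsto (a : ℝ) (ha : -1 < a) (ha2 : a ≤ 2) :
    Tendsto (fun γ : ℝ => ∫ s in Ioi γ, besselK 2 s / s * (s-γ)^a) (nhdsWithin 0 (Ioi 0)) atTop := by
  obtain ⟨c, hc, h⟩ := den_lower a ha ha2
  have t1 : Tendsto (fun γ : ℝ => c * Real.log (1 / (2*γ))) (nhdsWithin 0 (Ioi 0)) atTop := by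
    apply Tendsto.const_mul_atTop hc
    apply Real.tendsto_log_atTop.comp
    have : (fun γ : ℝ => 1 / (2*γ)) = fun γ => (1/2) * γ⁻¹ := by
      ext; rw [one_div, mul_inv]; norm_num
    rw [this]
    exact tendsto_inv_nhdsGT_zero.const_mul_atTop (by norm_num)
  refine tendsto_atTop_mono' _ ?_ t1
  filter_upwards [Ioo_mem_nhdsGT (show (0:ℝ) < 1/2 by norm_num)] with γ hγ
  exact h γ hγ.1 (by have := hγ.2; linarith)

lemma num_bound (a : ℝ) (ha : -1 < a) : ∀ ε > 0, ∃ B : ℝ, ∀ γ : ℝ, 0 < γ →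
    ∫ s in Ioi γ, besselK 1 s * (s-γ)^a ≤
      ε * (∫ s in Ioi γ, besselK 2 s / s * (s-γ)^a) + B := by
  intro ε hε
  obtain ⟨c, hc, hK2⟩ := bk2_lower
  obtain ⟨C, hC, hK1⟩ := bk_upper 1
  obtain ⟨M, hM0, hM⟩ := g_shift a ha
  set δ := min 1 (ε * c / C) with hδ
  have hδ0 : 0 < δ := lt_min one_pos (by positivity)
  have hδ1 : δ ≤ 1 := min_le_left _ _
  have hδ2 : C * δ ≤ ε * c := by
    have := min_le_right 1 (ε * c / C)
    rw [← hδ, le_div_iff₀ hC] at this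
    linarith
  refine ⟨C / δ^2 * M, fun γ hγ => ?_⟩
  have key : ∀ s : ℝ, 0 < s → besselK 1 s ≤ ε * (besselK 2 s / s) + C/δ^2 * Real.exp (-s/2) := by
    intro s hs
    have h1 := hK1 s hs
    have h0 := bk_nonneg 2 s
    rcases le_total s δ with h | h
    · have h2 := hK2 s hs (h.trans hδ1)
      have h3 : Real.exp (-s/2) ≤ 1 := Real.exp_le_one_iff.2 (by linarith)
      have h4 : 0 ≤ C/δ^2 * Real.exp (-s/2) := by positivity
      have h5 : C / s^(1+1) * Real.exp (-s/2) ≤ C / s^2 * 1 := by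
        norm_num only; gcongr
      have h6 : C / s^2 * 1 ≤ ε * (c / s^2 / s) := by
        have : C * s ≤ ε * c := le_trans (by gcongr) hδ2
        calc C/s^2*1 = (C*s)/s^3 := by field_simp
          _ ≤ (ε * c)/s^3 := by gcongr
          _ = _ := by field_simp
      have h7 : ε * (c / s^2 / s) ≤ ε * (besselK 2 s / s) := by gcongr
      linarith
    · have h5 : C / s^(1+1) * Real.exp (-s/2) ≤ C / δ^2 * Real.exp (-s/2) := by
        norm_num only; gcongr
      have : 0 ≤ ε * (besselK 2 s / s) := by positivity
      linarith
  have j1 := (bk_intOn' 2 a ha γ hγ).const_mul ε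
  have j2 := (hM γ hγ).1.const_mul (C/δ^2)
  have := setIntegral_mono_on (bk_intOn 1 a ha γ hγ) (j1.add j2) measurableSet_Ioi (by
    intro s hs
    have hs' : γ < s := hs
    have p : 0 < s - γ := sub_pos.2 hs
    have := mul_le_mul_of_nonneg_right (key s (hγ.trans hs')) (Real.rpow_nonneg p.le a)
    simp only [Pi.add_apply]
    linarith)
  simp only [Pi.add_apply] at this
  rw [integral_add j1 j2, integral_const_mul, integral_const_mul] at this
  refine this.trans ?_
  gcongr
  exact (hM γ hγ).2

/-- For `-1 < a ≤ 2`, the energy-to-pressure ratio tends to `3` in the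
ultrarelativistic limit `γ → 0⁺`. -/
theorem ultrarelativistic_limit_ratio_small_a (a : ℝ) (ha₁ : -1 < a) (ha₂ : a ≤ 2) :
    Filter.Tendsto (fun γ : ℝ => rRatio γ a) (nhdsWithin 0 (Set.Ioi 0)) (nhds 3) := by
  have hD := den_tendsto a ha₁ ha₂
  rw [Metric.tendsto_nhds]
  intro ε hε
  obtain ⟨B, hB⟩ := num_bound a ha₁ (ε/2) (by positivity)
  filter_upwards [self_mem_nhdsWithin, hD.eventually_gt_atTop 0,
    hD.eventually_gt_atTop (B / (ε/2))] with γ hγ hD0 hDB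
  have hγ0 : 0 < γ := hγ
  have h1 := hB γ hγ0
  have j1 := bk_intOn 1 a ha₁ γ hγ0
  have j2 := bk_intOn' 2 a ha₁ γ hγ0
  have hN : ∫ s in Ioi γ, (besselK 3 s - besselK 2 s / s) * (s - γ) ^ a =
      (∫ s in Ioi γ, besselK 1 s * (s-γ)^a) + 3 * ∫ s in Ioi γ, besselK 2 s / s * (s-γ)^a := by
    rw [← integral_const_mul, ← integral_add j1 (j2.const_mul 3)]
    refine setIntegral_congr_fun measurableSet_Ioi fun s hs => ?_
    rw [bk_rec s (hγ0.trans hs)]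
    ring
  have hN0 : 0 ≤ ∫ s in Ioi γ, besselK 1 s * (s-γ)^a :=
    setIntegral_nonneg measurableSet_Ioi fun s hs =>
      mul_nonneg (bk_nonneg 1 s) (Real.rpow_nonneg (sub_nonneg.2 (le_of_lt hs)) a)
  unfold rRatio
  rw [hN, add_div, mul_div_assoc, div_self hD0.ne', mul_one, Real.dist_eq, add_sub_cancel_right,
    abs_of_nonneg (by positivity), div_lt_iff₀ hD0]
  rw [div_lt_iff₀ (by positivity)] at hDB
  linarith
end

section
/- For every real a > −1, the dimensionless internal energy of the gas with internal structure converges in the classical (non-relativistic) limit γ → ∞ to that of a classical polyatomic gas with D = 2a + 5 degrees of freedom: lim_{γ→∞} (r(γ, a) − γ) = a + 5/2. -/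
open MeasureTheory Real Filter Set

lemma aux_cosh_ge (t : ℝ) : 1 + t ^ 2 / 2 ≤ Real.cosh t := by
  have h1 : Real.cosh t = 1 + 2 * Real.sinh (t / 2) ^ 2 := by
    have := Real.cosh_two_mul (t / 2)
    rw [Real.cosh_sq] at this
    rw [show 2 * (t / 2) = t by ring] at this
    linarith
  have h2 : (t / 2) ^ 2 ≤ Real.sinh (t / 2) ^ 2 := by
    rw [sq_le_sq, Real.abs_sinh]
    exact Real.self_le_sinh_iff.2 (abs_nonneg _)
  rw [h1]; nlinarith

lemma aux_bound (s : ℝ) (hs : 0 < s) (t : ℝ) (ht : 0 ≤ t) :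
    Real.exp (-s * Real.cosh t) * Real.cosh (3 * t) ≤ Real.exp (8 / s) * Real.exp (-t) := by
  have h1 : Real.cosh (3 * t) ≤ Real.exp (3 * t) := by
    rw [← Real.cosh_add_sinh]
    have : 0 ≤ Real.sinh (3 * t) := Real.sinh_nonneg_iff.2 (by linarith)
    linarith
  calc Real.exp (-s * Real.cosh t) * Real.cosh (3 * t)
      ≤ Real.exp (-s * Real.cosh t) * Real.exp (3 * t) := by gcongr
    _ = Real.exp (-s * Real.cosh t + 3 * t) := by rw [Real.exp_add]
    _ ≤ Real.exp (8 / s + -t) := by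
        apply Real.exp_le_exp.2
        have h2 : s * (1 + t ^ 2 / 2) ≤ s * Real.cosh t :=
          mul_le_mul_of_nonneg_left (aux_cosh_ge t) hs.le
        have h3 : 0 ≤ (s * t - 4) ^ 2 / (2 * s) := by positivity
        have h4 : (s * t - 4) ^ 2 / (2 * s) = s * t ^ 2 / 2 - 4 * t + 8 / s := by
          field_simp; ring
        nlinarith
    _ = _ := by rw [Real.exp_add]

lemma aux_int (s : ℝ) (hs : 0 < s) (h : ℝ → ℝ) (hc : Continuous h) (C : ℝ)
    (hb : ∀ t, |h t| ≤ C * Real.cosh (3 * t)) :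
    IntegrableOn (fun t => Real.exp (-s * Real.cosh t) * h t) (Set.Ioi 0) := by
  have hC : 0 ≤ C := by
    have := (abs_nonneg _).trans (hb 0)
    simpa using this
  have h1 : IntegrableOn (fun t : ℝ => C * (Real.exp (8 / s) * Real.exp (-t))) (Set.Ioi 0) :=
    (Integrable.const_mul (integrableOn_exp_neg_Ioi 0) _).const_mul C
  refine Integrable.mono' h1 ?_ ?_
  · exact Continuous.aestronglyMeasurable (by fun_prop)
  · refine (ae_restrict_iff' measurableSet_Ioi).2 (Eventually.of_forall fun t ht => ?_)
    rw [Real.norm_eq_abs, abs_mul, abs_of_pos (Real.exp_pos _)]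
    calc _ ≤ Real.exp (-s * Real.cosh t) * (C * Real.cosh (3 * t)) := by gcongr; exact hb t
      _ = C * (Real.exp (-s * Real.cosh t) * Real.cosh (3 * t)) := by ring
      _ ≤ _ := mul_le_mul_of_nonneg_left (aux_bound s hs t (le_of_lt ht)) hC

lemma k2_eq (s : ℝ) : besselK 2 s =
    ∫ t in Set.Ioi (0 : ℝ), Real.exp (-s * Real.cosh t) * (2 * Real.cosh t ^ 2 - 1) := by
  unfold besselK
  congr 1; ext t
  push_cast
  rw [Real.cosh_two_mul, Real.sinh_sq]; ring

lemma k3_eq (s : ℝ) : besselK 3 s =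
    ∫ t in Set.Ioi (0 : ℝ), Real.exp (-s * Real.cosh t) * (4 * Real.cosh t ^ 3 - 3 * Real.cosh t) := by
  unfold besselK
  congr 1; ext t
  push_cast
  rw [Real.cosh_three_mul]

lemma k2_int (s : ℝ) (hs : 0 < s) :
    IntegrableOn (fun t => Real.exp (-s * Real.cosh t) * (2 * Real.cosh t ^ 2 - 1)) (Set.Ioi 0) := by
  refine aux_int s hs _ (by fun_prop) 2 fun t => ?_
  have := Real.one_le_cosh t
  rw [Real.cosh_three_mul, abs_of_nonneg (by nlinarith)]
  nlinarith [mul_nonneg (sub_nonneg.2 this) (sq_nonneg (Real.cosh t))]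

lemma k3_int (s : ℝ) (hs : 0 < s) :
    IntegrableOn (fun t => Real.exp (-s * Real.cosh t) * (4 * Real.cosh t ^ 3 - 3 * Real.cosh t))
      (Set.Ioi 0) := by
  refine aux_int s hs _ (by fun_prop) 1 fun t => ?_
  rw [← Real.cosh_three_mul, abs_of_pos (Real.cosh_pos _), one_mul]

lemma kd_eq (s : ℝ) (hs : 0 < s) : besselK 3 s - besselK 2 s =
    ∫ t in Set.Ioi (0 : ℝ), Real.exp (-s * Real.cosh t) *
      ((Real.cosh t - 1) * (4 * Real.cosh t ^ 2 + 2 * Real.cosh t - 1)) := by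
  rw [k2_eq, k3_eq, ← integral_sub (k3_int s hs) (k2_int s hs)]
  congr 1; ext t; ring

lemma kd_int (s : ℝ) (hs : 0 < s) :
    IntegrableOn (fun t => Real.exp (-s * Real.cosh t) *
      ((Real.cosh t - 1) * (4 * Real.cosh t ^ 2 + 2 * Real.cosh t - 1))) (Set.Ioi 0) := by
  have := (k3_int s hs).sub (k2_int s hs)
  refine this.congr (Eventually.of_forall fun t => ?_)
  simp only [Pi.sub_apply]; ring

lemma kg_int (s : ℝ) (hs : 0 < s) :
    IntegrableOn (fun t => Real.exp (-s * Real.cosh t) *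
      (8 * Real.cosh t ^ 2 - 4 - 2 * Real.cosh t + 1 / (1 + Real.cosh t))) (Set.Ioi 0) := by
  refine aux_int s hs _ ?_ 9 fun t => ?_
  · have : ∀ t : ℝ, 1 + Real.cosh t ≠ 0 := fun t => by positivity
    fun_prop (disch := assumption)
  have h1 := Real.one_le_cosh t
  have h2 : 0 ≤ 1 / (1 + Real.cosh t) := by positivity
  have h3 : 1 / (1 + Real.cosh t) ≤ 1 := by
    rw [div_le_one (by positivity)]; linarith
  rw [Real.cosh_three_mul, abs_of_nonneg (by nlinarith)]
  nlinarith [mul_nonneg (sub_nonneg.2 h1) (sq_nonneg (Real.cosh t))]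

/-- integration by parts -/
lemma kd_ibp (s : ℝ) (hs : 0 < s) : s * (besselK 3 s - besselK 2 s) =
    ∫ t in Set.Ioi (0 : ℝ), Real.exp (-s * Real.cosh t) *
      (8 * Real.cosh t ^ 2 - 4 - 2 * Real.cosh t + 1 / (1 + Real.cosh t)) := by
  have key := integral_Ioi_of_hasDerivAt_of_tendsto' (a := (0 : ℝ)) (m := (0 : ℝ))
    (f := fun t => Real.exp (-s * Real.cosh t) *
      (4 * Real.sinh t * Real.cosh t - 2 * Real.sinh t + Real.sinh t / (1 + Real.cosh t)))
    (f' := fun t => Real.exp (-s * Real.cosh t) *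
      (8 * Real.cosh t ^ 2 - 4 - 2 * Real.cosh t + 1 / (1 + Real.cosh t)) -
      s * (Real.exp (-s * Real.cosh t) *
      ((Real.cosh t - 1) * (4 * Real.cosh t ^ 2 + 2 * Real.cosh t - 1)))) ?_ ?_ ?_
  · rw [integral_sub (kg_int s hs) ((kd_int s hs).const_mul s), integral_const_mul,
      ← kd_eq s hs] at key
    simp only [Real.sinh_zero] at key
    norm_num at key
    simp only [neg_mul, one_div] at key ⊢
    linarith
  · intro t _
    have hp : 1 + Real.cosh t ≠ 0 := by positivity
    have d1 : HasDerivAt (fun t => Real.exp (-s * Real.cosh t))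
        (Real.exp (-s * Real.cosh t) * (-s * Real.sinh t)) t :=
      ((Real.hasDerivAt_cosh t).const_mul (-s)).exp
    have d2 := (((Real.hasDerivAt_sinh t).const_mul 4).mul (Real.hasDerivAt_cosh t)).sub
      ((Real.hasDerivAt_sinh t).const_mul 2)
    have d3 := (Real.hasDerivAt_sinh t).div ((Real.hasDerivAt_cosh t).const_add 1) hp
    refine (d1.mul (d2.add d3)).congr_deriv ?_
    have hq := Real.sinh_sq t
    simp only [Pi.add_apply, Pi.sub_apply, Pi.mul_apply, Pi.div_apply]
    have e : Real.sinh t * (4 * Real.sinh t * Real.cosh t - 2 * Real.sinh t +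
        Real.sinh t / (1 + Real.cosh t)) =
        (Real.cosh t - 1) * (4 * Real.cosh t ^ 2 + 2 * Real.cosh t - 1) := by
      field_simp
      rw [hq]; ring
    have e2 : (Real.cosh t * (1 + Real.cosh t) - Real.sinh t * Real.sinh t) /
        (1 + Real.cosh t) ^ 2 = 1 / (1 + Real.cosh t) := by
      rw [← sq, hq]; field_simp; ring
    rw [e2, ← e]
    linear_combination 4 * Real.exp (-s * Real.cosh t) * hq
  · exact (kg_int s hs).sub ((kd_int s hs).const_mul s)
  · have hlim : Tendsto (fun t : ℝ => 7 * (Real.exp (8 / s) * Real.exp (-t))) atTop (nhds 0) := by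
      have := ((Real.tendsto_exp_neg_atTop_nhds_zero).const_mul (Real.exp (8 / s))).const_mul 7
      simpa using this
    refine squeeze_zero_norm' ?_ hlim
    filter_upwards [eventually_ge_atTop 0] with t ht
    have hc := Real.one_le_cosh t
    have hs0 : 0 ≤ Real.sinh t := Real.sinh_nonneg_iff.2 ht
    have hsc : Real.sinh t ≤ Real.cosh t := (Real.sinh_lt_cosh t).le
    have h2 : 0 ≤ Real.sinh t / (1 + Real.cosh t) := by positivity
    have h3 : Real.sinh t / (1 + Real.cosh t) ≤ 1 := by
      rw [div_le_one (by positivity)]; linarith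
    have h5 : Real.sinh t * Real.cosh t ≤ Real.cosh t ^ 2 := by nlinarith
    have h6 : Real.sinh t ≤ Real.sinh t * Real.cosh t := by nlinarith
    rw [Real.norm_eq_abs, abs_of_nonneg (mul_nonneg (Real.exp_pos _).le (by nlinarith))]
    calc _ ≤ Real.exp (-s * Real.cosh t) * (7 * Real.cosh (3 * t)) := by
          gcongr
          rw [Real.cosh_three_mul]
          nlinarith [mul_nonneg (sub_nonneg.2 hc) (sq_nonneg (Real.cosh t))]
      _ = 7 * (Real.exp (-s * Real.cosh t) * Real.cosh (3 * t)) := by ring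
      _ ≤ _ := mul_le_mul_of_nonneg_left (aux_bound s hs t ht) (by norm_num)

lemma kd_lower (s : ℝ) (hs : 0 < s) : 5 / 2 * besselK 2 s ≤ s * (besselK 3 s - besselK 2 s) := by
  rw [kd_ibp s hs, k2_eq, ← integral_const_mul]
  refine setIntegral_mono ((k2_int s hs).const_mul _) (kg_int s hs) fun t => ?_
  have hc := Real.one_le_cosh t
  have h : 0 ≤ (Real.cosh t - 1) * (3 * Real.cosh t + 1 - 1 / (2 * (1 + Real.cosh t))) := by
    apply mul_nonneg (by linarith)
    have : 1 / (2 * (1 + Real.cosh t)) ≤ 1 := by rw [div_le_one (by positivity)]; linarith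
    linarith
  have e : (Real.cosh t - 1) * (3 * Real.cosh t + 1 - 1 / (2 * (1 + Real.cosh t))) =
      (8 * Real.cosh t ^ 2 - 4 - 2 * Real.cosh t + 1 / (1 + Real.cosh t)) -
      5 / 2 * (2 * Real.cosh t ^ 2 - 1) := by
    field_simp; ring
  have := mul_nonneg (Real.exp_pos (-s * Real.cosh t)).le (e ▸ h)
  show 5 / 2 * (Real.exp (-s * Real.cosh t) * _) ≤ _
  linarith

lemma kd_upper (s : ℝ) (hs : 0 < s) :
    s * (besselK 3 s - besselK 2 s) ≤ 5 / 2 * besselK 2 s + (besselK 3 s - besselK 2 s) := by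
  rw [kd_ibp s hs, kd_eq s hs, k2_eq, ← integral_const_mul,
    ← integral_add ((k2_int s hs).const_mul _) (kd_int s hs)]
  refine setIntegral_mono (kg_int s hs) (((k2_int s hs).const_mul _).add (kd_int s hs)) fun t => ?_
  have hc := Real.one_le_cosh t
  have h : 0 ≤ (Real.cosh t - 1) * ((4 * Real.cosh t ^ 2 + 2 * Real.cosh t - 1) -
      (3 * Real.cosh t + 1 - 1 / (2 * (1 + Real.cosh t)))) := by
    apply mul_nonneg (by linarith)
    have : 0 ≤ 1 / (2 * (1 + Real.cosh t)) := by positivity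
    nlinarith
  have e : (Real.cosh t - 1) * ((4 * Real.cosh t ^ 2 + 2 * Real.cosh t - 1) -
      (3 * Real.cosh t + 1 - 1 / (2 * (1 + Real.cosh t)))) =
      5 / 2 * (2 * Real.cosh t ^ 2 - 1) +
      (Real.cosh t - 1) * (4 * Real.cosh t ^ 2 + 2 * Real.cosh t - 1) -
      (8 * Real.cosh t ^ 2 - 4 - 2 * Real.cosh t + 1 / (1 + Real.cosh t)) := by
    field_simp; ring
  have := mul_nonneg (Real.exp_pos (-s * Real.cosh t)).le (e ▸ h)
  show _ ≤ 5 / 2 * (Real.exp (-s * Real.cosh t) * _) + _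
  linarith

lemma k2_pos (s : ℝ) (hs : 0 < s) : 0 < besselK 2 s := by
  rw [k2_eq]
  have hp : ∀ t : ℝ, 0 < Real.exp (-s * Real.cosh t) * (2 * Real.cosh t ^ 2 - 1) := fun t => by
    have := Real.one_le_cosh t
    exact mul_pos (Real.exp_pos _) (by nlinarith)
  rw [setIntegral_pos_iff_support_of_nonneg_ae
    (Eventually.of_forall fun t => (hp t).le) (k2_int s hs)]
  have : Function.support (fun t => Real.exp (-s * Real.cosh t) * (2 * Real.cosh t ^ 2 - 1)) =
      Set.univ := by
    ext t; simpa using (hp t).ne'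
  rw [this]; simp

lemma k2_decay (s u : ℝ) (hs : 0 < s) (hu : 0 ≤ u) :
    besselK 2 (s + u) ≤ Real.exp (-u) * besselK 2 s := by
  rw [k2_eq, k2_eq, ← integral_const_mul]
  refine setIntegral_mono (k2_int _ (by linarith)) ((k2_int s hs).const_mul _) fun t => ?_
  have hc := Real.one_le_cosh t
  show _ ≤ Real.exp (-u) * (_ * _)
  rw [← mul_assoc, ← Real.exp_add]
  apply mul_le_mul_of_nonneg_right _ (by nlinarith)
  apply Real.exp_le_exp.2
  nlinarith

lemma kd_decay (s u : ℝ) (hs : 0 < s) (hu : 0 ≤ u) :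
    besselK 3 (s + u) - besselK 2 (s + u) ≤ Real.exp (-u) * (besselK 3 s - besselK 2 s) := by
  rw [kd_eq _ (by linarith), kd_eq _ hs, ← integral_const_mul]
  refine setIntegral_mono (kd_int _ (by linarith)) ((kd_int s hs).const_mul _) fun t => ?_
  have hc := Real.one_le_cosh t
  show _ ≤ Real.exp (-u) * (_ * _)
  rw [← mul_assoc (Real.exp (-u)), ← Real.exp_add]
  apply mul_le_mul_of_nonneg_right _ (mul_nonneg (by linarith) (by nlinarith))
  apply Real.exp_le_exp.2
  nlinarith

lemma kd_nonneg (s : ℝ) (hs : 0 < s) : 0 ≤ besselK 3 s - besselK 2 s := by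
  have := kd_lower s hs
  have := k2_pos s hs
  by_contra h
  push Not at h
  nlinarith

lemma k2_below (s u : ℝ) (hs : 0 < s) (hu : 0 ≤ u) :
    Real.exp (-u) * (besselK 2 s - u * (besselK 3 s - besselK 2 s)) ≤ besselK 2 (s + u) := by
  rw [kd_eq _ hs, k2_eq, k2_eq, ← integral_const_mul,
    ← integral_sub (k2_int s hs) ((kd_int s hs).const_mul _), ← integral_const_mul]
  refine setIntegral_mono (((k2_int s hs).sub ((kd_int s hs).const_mul _)).const_mul _)
    (k2_int _ (by linarith)) fun t => ?_
  have hc := Real.one_le_cosh t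
  beta_reduce
  have e : Real.exp (-(s + u) * Real.cosh t) =
      Real.exp (-u) * Real.exp (-s * Real.cosh t) * Real.exp (-u * (Real.cosh t - 1)) := by
    rw [← Real.exp_add, ← Real.exp_add]; congr 1; ring
  have h1 := Real.add_one_le_exp (-u * (Real.cosh t - 1))
  have h2 : (2 * Real.cosh t ^ 2 - 1) - u * ((Real.cosh t - 1) *
      (4 * Real.cosh t ^ 2 + 2 * Real.cosh t - 1)) ≤
      Real.exp (-u * (Real.cosh t - 1)) * (2 * Real.cosh t ^ 2 - 1) := by
    have h3 := mul_le_mul_of_nonneg_right h1 (show 0 ≤ 2 * Real.cosh t ^ 2 - 1 by nlinarith)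
    have h4 : 0 ≤ (u * (Real.cosh t - 1)) * (2 * Real.cosh t ^ 2 + 2 * Real.cosh t) :=
      mul_nonneg (mul_nonneg hu (by linarith)) (by positivity)
    linarith
  rw [e]
  have := mul_le_mul_of_nonneg_left h2
    (show 0 ≤ Real.exp (-u) * Real.exp (-s * Real.cosh t) by positivity)
  linarith

lemma k2_anti (γ : ℝ) (hγ : 0 < γ) :
    AntitoneOn (fun u => besselK 2 (γ + u)) (Set.Ioi 0) := by
  intro x hx y hy hxy
  have hx : 0 < x := hx
  have h := k2_decay (γ + x) (y - x) (by linarith) (by linarith)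
  have hp := k2_pos (γ + x) (by linarith)
  have he : Real.exp (-(y - x)) ≤ 1 := Real.exp_le_one_iff.2 (by linarith)
  rw [show γ + x + (y - x) = γ + y by ring] at h
  show besselK 2 (γ + y) ≤ besselK 2 (γ + x)
  nlinarith

lemma kd_anti (γ : ℝ) (hγ : 0 < γ) :
    AntitoneOn (fun u => besselK 3 (γ + u) - besselK 2 (γ + u)) (Set.Ioi 0) := by
  intro x hx y hy hxy
  have hx : 0 < x := hx
  have h := kd_decay (γ + x) (y - x) (by linarith) (by linarith)
  have hp := kd_nonneg (γ + x) (by linarith)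
  have he : Real.exp (-(y - x)) ≤ 1 := Real.exp_le_one_iff.2 (by linarith)
  rw [show γ + x + (y - x) = γ + y by ring] at h
  show besselK 3 (γ + y) - besselK 2 (γ + y) ≤ besselK 3 (γ + x) - besselK 2 (γ + x)
  nlinarith

lemma gam_int (b : ℝ) (hb : -1 < b) :
    IntegrableOn (fun u : ℝ => Real.exp (-u) * u ^ b) (Set.Ioi 0) := by
  have := Real.GammaIntegral_convergent (s := b + 1) (by linarith)
  simpa using this

lemma gam_eq (b : ℝ) (hb : -1 < b) :
    ∫ u in Set.Ioi (0 : ℝ), Real.exp (-u) * u ^ b = Real.Gamma (b + 1) := by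
  rw [Real.Gamma_eq_integral (by linarith)]
  simp

/-- Generic integrability. -/
lemma outer_int (F : ℝ → ℝ) (C b : ℝ) (hb : -1 < b)
    (hm : AEMeasurable F (volume.restrict (Set.Ioi 0)))
    (h0 : ∀ u, 0 < u → 0 ≤ F u) (h1 : ∀ u, 0 < u → F u ≤ Real.exp (-u) * C) :
    IntegrableOn (fun u => F u * u ^ b) (Set.Ioi 0) := by
  refine Integrable.mono' ((gam_int b hb).const_mul C) ?_ ?_
  · exact (hm.mul (by fun_prop)).aestronglyMeasurable
  · refine (ae_restrict_iff' measurableSet_Ioi).2 (Eventually.of_forall fun u hu => ?_)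
    have hu : 0 < u := hu
    have hp : 0 ≤ u ^ b := Real.rpow_nonneg hu.le b
    rw [Real.norm_eq_abs, abs_of_nonneg (mul_nonneg (h0 u hu) hp)]
    have := mul_le_mul_of_nonneg_right (h1 u hu) hp
    linarith

lemma w_int (γ b : ℝ) (hγ : 0 < γ) (hb : -1 < b) :
    IntegrableOn (fun u => besselK 2 (γ + u) / (γ + u) * u ^ b) (Set.Ioi 0) := by
  refine outer_int _ (besselK 2 γ / γ) b hb ?_ ?_ ?_
  · exact (aemeasurable_restrict_of_antitoneOn measurableSet_Ioi (k2_anti γ hγ)).div (by fun_prop)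
  · intro u hu
    exact div_nonneg (k2_pos _ (by linarith)).le (by linarith)
  · intro u hu
    have := k2_pos _ hγ
    rw [← mul_div_assoc]
    apply div_le_div₀ (by positivity) (k2_decay γ u hγ hu.le) hγ (by linarith)

lemma d_int (γ b : ℝ) (hγ : 0 < γ) (hb : -1 < b) :
    IntegrableOn (fun u => (besselK 3 (γ + u) - besselK 2 (γ + u)) * u ^ b) (Set.Ioi 0) := by
  refine outer_int _ (besselK 3 γ - besselK 2 γ) b hb ?_ ?_ ?_
  · exact aemeasurable_restrict_of_antitoneOn measurableSet_Ioi (kd_anti γ hγ)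
  · intro u hu
    exact kd_nonneg _ (by linarith)
  · intro u hu
    exact kd_decay γ u hγ hu.le

/-- Laplace-type integral. -/
noncomputable def wJ (γ b : ℝ) : ℝ :=
  ∫ u in Set.Ioi (0 : ℝ), besselK 2 (γ + u) / (γ + u) * u ^ b

lemma wJ_upper (γ b : ℝ) (hγ : 0 < γ) (hb : -1 < b) :
    wJ γ b ≤ besselK 2 γ / γ * Real.Gamma (b + 1) := by
  rw [← gam_eq b hb, ← integral_const_mul]
  refine setIntegral_mono_on (w_int γ b hγ hb) ((gam_int b hb).const_mul _) measurableSet_Ioi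
    fun u hu => ?_
  have hu : 0 < u := hu
  have := k2_pos _ hγ
  rw [← mul_assoc]
  apply mul_le_mul_of_nonneg_right _ (Real.rpow_nonneg hu.le b)
  rw [mul_comm, ← mul_div_assoc]
  apply div_le_div₀ (by positivity) (k2_decay γ u hγ hu.le) hγ (by linarith)

lemma w_below (γ u : ℝ) (hγ : 1 < γ) (hu : 0 < u) :
    besselK 2 γ / γ * (Real.exp (-u) * (1 - (7 / 2) / (γ - 1) * u)) ≤
      besselK 2 (γ + u) / (γ + u) := by
  have hγ0 : 0 < γ := by linarith
  have hK := k2_pos γ hγ0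
  have hKu := k2_pos (γ + u) (by linarith)
  have h1 := k2_below γ u hγ0 hu.le
  have h2 := k2_decay γ u hγ0 hu.le
  have h3 := kd_upper γ hγ0
  have h4 : besselK 3 γ - besselK 2 γ ≤ (5 / 2) / (γ - 1) * besselK 2 γ := by
    rw [div_mul_eq_mul_div, le_div_iff₀ (by linarith)]; linarith
  have h5 : besselK 2 (γ + u) - u / γ * besselK 2 (γ + u) ≤ γ * (besselK 2 (γ + u) / (γ + u)) := by
    have : γ * (besselK 2 (γ + u) / (γ + u)) - (besselK 2 (γ + u) - u / γ * besselK 2 (γ + u)) =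
      besselK 2 (γ + u) * (u ^ 2 / (γ * (γ + u))) := by
      have : γ + u ≠ 0 := by positivity
      field_simp; ring
    have : 0 ≤ besselK 2 (γ + u) * (u ^ 2 / (γ * (γ + u))) := by positivity
    linarith
  have h6 : u / γ * besselK 2 (γ + u) ≤ u / (γ - 1) * (Real.exp (-u) * besselK 2 γ) := by
    apply mul_le_mul _ h2 hKu.le (div_nonneg hu.le (by linarith))
    exact div_le_div_of_nonneg_left hu.le (by linarith) (by linarith)
  have h7 : Real.exp (-u) * (u * (besselK 3 γ - besselK 2 γ)) ≤
      Real.exp (-u) * (u * ((5 / 2) / (γ - 1) * besselK 2 γ)) := by gcongr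
  have h8 : Real.exp (-u) * besselK 2 γ * (1 - (7 / 2) / (γ - 1) * u) ≤
      γ * (besselK 2 (γ + u) / (γ + u)) := by
    have e : Real.exp (-u) * besselK 2 γ * (1 - (7 / 2) / (γ - 1) * u) =
      Real.exp (-u) * besselK 2 γ - Real.exp (-u) * (u * ((5 / 2) / (γ - 1) * besselK 2 γ))
      - u / (γ - 1) * (Real.exp (-u) * besselK 2 γ) := by ring
    rw [e]; linarith
  calc _ = (Real.exp (-u) * besselK 2 γ * (1 - (7 / 2) / (γ - 1) * u)) / γ := by ring
    _ ≤ _ := by rw [div_le_iff₀ hγ0]; linarith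

lemma wJ_lower (γ b : ℝ) (hγ : 1 < γ) (hb : -1 < b) :
    besselK 2 γ / γ * (Real.Gamma (b + 1) - (7 / 2) / (γ - 1) * Real.Gamma (b + 1 + 1)) ≤
      wJ γ b := by
  rw [← gam_eq b hb, ← gam_eq (b + 1) (by linarith), ← integral_const_mul ((7 / 2) / (γ - 1)),
    ← integral_sub (gam_int b hb) ((gam_int (b + 1) (by linarith)).const_mul _),
    ← integral_const_mul]
  refine setIntegral_mono_on (((gam_int b hb).sub
    ((gam_int (b + 1) (by linarith)).const_mul _)).const_mul _)
    (w_int γ b (by linarith) hb) measurableSet_Ioi fun u hu => ?_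
  have hu : 0 < u := hu
  have := mul_le_mul_of_nonneg_right (w_below γ u hγ hu) (Real.rpow_nonneg hu.le b)
  rw [Real.rpow_add_one hu.ne']
  refine le_trans (le_of_eq ?_) this
  ring

lemma wJ_lim (b : ℝ) (hb : -1 < b) :
    Tendsto (fun γ => wJ γ b / (besselK 2 γ / γ)) atTop (nhds (Real.Gamma (b + 1))) := by
  have hl : Tendsto (fun γ : ℝ => Real.Gamma (b + 1) - (7 / 2) / (γ - 1) * Real.Gamma (b + 1 + 1))
      atTop (nhds (Real.Gamma (b + 1))) := by
    have h1 : Tendsto (fun γ : ℝ => (7 / 2) / (γ - 1)) atTop (nhds 0) :=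
      (tendsto_atTop_add_const_right atTop (-1 : ℝ) tendsto_id).const_div_atTop (7 / 2)
    simpa using (h1.mul_const (Real.Gamma (b + 1 + 1))).const_sub (Real.Gamma (b + 1))
  refine tendsto_of_tendsto_of_tendsto_of_le_of_le' hl tendsto_const_nhds ?_ ?_
  · filter_upwards [eventually_gt_atTop 1] with γ hγ
    have := k2_pos γ (by linarith)
    rw [le_div_iff₀ (by positivity), mul_comm]
    exact wJ_lower γ b hγ hb
  · filter_upwards [eventually_gt_atTop 1] with γ hγ
    have := k2_pos γ (by linarith)
    rw [div_le_iff₀ (by positivity), mul_comm]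
    exact wJ_upper γ b (by linarith) hb

lemma shift_int (γ : ℝ) (F : ℝ → ℝ) :
    ∫ s in Set.Ioi γ, F s = ∫ u in Set.Ioi (0 : ℝ), F (γ + u) := by
  have := (measurePreserving_add_left (volume : Measure ℝ) γ).setIntegral_preimage_emb
    (measurableEmbedding_addLeft γ) F (Set.Ioi γ)
  rw [← this]
  simp

/-- Classical (non-relativistic) limit of the dimensionless internal energy:
`r(γ, a) - γ → a + 5/2 = D/2` as `γ → ∞`. -/
theorem classical_limit_internal_energy (a : ℝ) (ha : -1 < a) :
    Filter.Tendsto (fun γ : ℝ => rRatio γ a - γ) Filter.atTop (nhds (a + 5 / 2)) := by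
  have hG : 0 < Real.Gamma (a + 1) := Real.Gamma_pos_of_pos (by linarith)
  have hpos : ∀ᶠ γ in atTop, 0 < wJ γ a := by
    filter_upwards [(wJ_lim a ha).eventually (lt_mem_nhds hG), eventually_gt_atTop 1] with γ h hγ
    have := k2_pos γ (by linarith)
    exact (div_pos_iff_of_pos_right (by positivity)).1 h
  have hM : Tendsto (fun γ => wJ γ (a + 1) / wJ γ a) atTop (nhds (a + 1)) := by
    have h := (wJ_lim (a + 1) (by linarith)).div (wJ_lim a ha) hG.ne'
    rw [Real.Gamma_add_one (by linarith), mul_div_assoc, div_self hG.ne', mul_one] at h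
    refine h.congr' ?_
    filter_upwards [eventually_gt_atTop 1] with γ hγ
    have := k2_pos γ (by linarith)
    exact div_div_div_cancel_right₀ (by positivity) _ _
  set I := fun γ : ℝ => ∫ u in Set.Ioi (0 : ℝ), (besselK 3 (γ + u) - besselK 2 (γ + u)) * u ^ a
    with hI
  have hId : Tendsto (fun γ => I γ / wJ γ a) atTop (nhds (5 / 2)) := by
    have hu : Tendsto (fun γ : ℝ => 5 / 2 + (5 / 2) / (γ - 1)) atTop (nhds (5 / 2)) := by
      have h1 : Tendsto (fun γ : ℝ => (5 / 2) / (γ - 1)) atTop (nhds 0) :=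
        (tendsto_atTop_add_const_right atTop (-1 : ℝ) tendsto_id).const_div_atTop (5 / 2)
      simpa using h1.const_add (5 / 2)
    refine tendsto_of_tendsto_of_tendsto_of_le_of_le' tendsto_const_nhds hu ?_ ?_
    · filter_upwards [hpos, eventually_gt_atTop 1] with γ hp hγ
      rw [le_div_iff₀ hp, wJ, ← integral_const_mul]
      refine setIntegral_mono_on ((w_int γ a (by linarith) ha).const_mul _)
        (d_int γ a (by linarith) ha) measurableSet_Ioi fun u hu => ?_
      have hu : 0 < u := hu
      rw [← mul_assoc]
      apply mul_le_mul_of_nonneg_right _ (Real.rpow_nonneg hu.le a)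
      rw [← mul_div_assoc, div_le_iff₀ (by linarith)]
      linarith [kd_lower (γ + u) (by linarith)]
    · filter_upwards [hpos, eventually_gt_atTop 1] with γ hp hγ
      rw [div_le_iff₀ hp, wJ, ← integral_const_mul]
      refine setIntegral_mono_on (d_int γ a (by linarith) ha)
        ((w_int γ a (by linarith) ha).const_mul _) measurableSet_Ioi fun u hu => ?_
      have hu : 0 < u := hu
      rw [← mul_assoc]
      apply mul_le_mul_of_nonneg_right _ (Real.rpow_nonneg hu.le a)
      have h1 := kd_upper (γ + u) (by linarith)
      have h2 := k2_pos (γ + u) (by linarith)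
      have h3 : besselK 3 (γ + u) - besselK 2 (γ + u) ≤ (5 / 2) / (γ - 1) * besselK 2 (γ + u) := by
        rw [div_mul_eq_mul_div, le_div_iff₀ (by linarith)]
        have := mul_nonneg hu.le (kd_nonneg (γ + u) (by linarith))
        linarith
      rw [← mul_div_assoc, le_div_iff₀ (by linarith)]
      linarith
  have hfin := (hId.sub_const 1).add hM
  rw [show (5 / 2 - 1 + (a + 1) : ℝ) = a + 5 / 2 by ring] at hfin
  refine hfin.congr' ?_
  filter_upwards [hpos, eventually_gt_atTop 1] with γ hp hγ
  have hden : ∫ s in Set.Ioi γ, (besselK 2 s / s) * (s - γ) ^ a = wJ γ a := by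
    rw [shift_int, wJ]; simp
  have hnum : ∫ s in Set.Ioi γ, (besselK 3 s - besselK 2 s / s) * (s - γ) ^ a =
      I γ - wJ γ a + wJ γ (a + 1) + γ * wJ γ a := by
    have i1 := d_int γ a (by linarith) ha
    have i2 := w_int γ a (by linarith) ha
    have i3 := w_int γ (a + 1) (by linarith) (by linarith)
    have i12 : IntegrableOn (fun u => (besselK 3 (γ + u) - besselK 2 (γ + u)) * u ^ a -
        besselK 2 (γ + u) / (γ + u) * u ^ a) (Set.Ioi 0) := i1.sub i2
    have i123 : IntegrableOn (fun u => (besselK 3 (γ + u) - besselK 2 (γ + u)) * u ^ a -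
        besselK 2 (γ + u) / (γ + u) * u ^ a + besselK 2 (γ + u) / (γ + u) * u ^ (a + 1))
        (Set.Ioi 0) := i12.add i3
    rw [shift_int, hI]
    simp only [wJ]
    rw [← integral_const_mul, ← integral_sub i1 i2, ← integral_add i12 i3,
      ← integral_add i123 (i2.const_mul γ)]
    refine setIntegral_congr_fun measurableSet_Ioi fun u hu => ?_
    have hu : 0 < u := hu
    have hne : γ + u ≠ 0 := by positivity
    simp only [add_sub_cancel_left]
    rw [Real.rpow_add_one hu.ne']
    field_simp
    ring
  unfold rRatio
  rw [hden, hnum]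
  field_simp
  ring
end

section
/- For every a > −1, the function γ ↦ r(γ, a) is differentiable on (0, ∞), and the dimensionless specific heat ĉ_V(γ) = r(γ, a) − γ · ∂r/∂γ(γ, a) converges in the classical limit to the polyatomic value: lim_{γ→∞} ( r(γ, a) − γ · ∂r/∂γ(γ, a) ) = a + 5/2. -/
open MeasureTheory Real Filter Set

/-- Continuous functions with at most polynomial growth in `cosh`. -/
def CoshBd (f : ℝ → ℝ) : Prop :=
  Continuous f ∧ ∃ (C : ℝ) (m : ℕ), 0 ≤ C ∧ ∀ t, |f t| ≤ C * cosh t ^ m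

lemma CoshBd.mul {f g : ℝ → ℝ} (hf : CoshBd f) (hg : CoshBd g) :
    CoshBd (fun t => f t * g t) := by
  obtain ⟨hf, C, m, hC, h⟩ := hf
  obtain ⟨hg, D, n, hD, k⟩ := hg
  refine ⟨hf.mul hg, C * D, m + n, by positivity, fun t => ?_⟩
  rw [abs_mul, pow_add]
  have := cosh_pos t
  calc |f t| * |g t| ≤ (C * cosh t ^ m) * (D * cosh t ^ n) :=
        mul_le_mul (h t) (k t) (abs_nonneg _) (by positivity)
    _ = _ := by ring

lemma CoshBd.add {f g : ℝ → ℝ} (hf : CoshBd f) (hg : CoshBd g) :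
    CoshBd (fun t => f t + g t) := by
  obtain ⟨hf, C, m, hC, h⟩ := hf
  obtain ⟨hg, D, n, hD, k⟩ := hg
  refine ⟨hf.add hg, C + D, m + n, by positivity, fun t => ?_⟩
  have h1 := one_le_cosh t
  have h2 : cosh t ^ m ≤ cosh t ^ (m + n) := pow_le_pow_right₀ h1 (by omega)
  have h3 : cosh t ^ n ≤ cosh t ^ (m + n) := pow_le_pow_right₀ h1 (by omega)
  calc |f t + g t| ≤ |f t| + |g t| := abs_add_le _ _
    _ ≤ C * cosh t ^ m + D * cosh t ^ n := add_le_add (h t) (k t)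
    _ ≤ C * cosh t ^ (m + n) + D * cosh t ^ (m + n) := by gcongr
    _ = _ := by ring

lemma CoshBd.const (c : ℝ) : CoshBd (fun _ => c) :=
  ⟨continuous_const, |c|, 0, abs_nonneg _, fun t => by simp⟩

lemma CoshBd.cosh : CoshBd (fun t => Real.cosh t) :=
  ⟨Real.continuous_cosh, 1, 1, by norm_num, fun t => by simp [abs_of_pos (cosh_pos t)]⟩

lemma CoshBd.sinh : CoshBd (fun t => Real.sinh t) :=
  ⟨Real.continuous_sinh, 1, 1, by norm_num, fun t => by
    simp only [pow_one, one_mul]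
    exact abs_le_of_sq_le_sq (by rw [cosh_sq]; linarith) (cosh_pos t).le⟩

lemma CoshBd.pow {f : ℝ → ℝ} (hf : CoshBd f) (n : ℕ) : CoshBd (fun t => f t ^ n) := by
  induction n with
  | zero => simpa using CoshBd.const 1
  | succ n ih => simpa only [pow_succ] using ih.mul hf

lemma CoshBd.sub {f g : ℝ → ℝ} (hf : CoshBd f) (hg : CoshBd g) :
    CoshBd (fun t => f t - g t) := by
  simpa [sub_eq_add_neg] using hf.add ((CoshBd.const (-1)).mul hg)

lemma CoshBd.rpow (p : ℝ) : CoshBd (fun t => Real.cosh t ^ p) := by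
  refine ⟨Real.continuous_cosh.rpow_const fun t => Or.inl (cosh_pos t).ne', 1, ⌈|p|⌉₊, by norm_num,
    fun t => ?_⟩
  rw [abs_of_pos (rpow_pos_of_pos (cosh_pos t) p), one_mul, ← rpow_natCast]
  exact rpow_le_rpow_of_exponent_le (one_le_cosh t) ((le_abs_self p).trans (Nat.le_ceil _))

lemma one_add_sq_le_cosh (t : ℝ) : 1 + t ^ 2 / 2 ≤ cosh t := by
  wlog ht : 0 ≤ t generalizing t
  · simpa using this (-t) (by linarith)
  have h : cosh t = 1 + 2 * sinh (t / 2) ^ 2 := by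
    have := cosh_two_mul (t / 2)
    rw [cosh_sq, mul_div_cancel₀ t two_ne_zero] at this
    linarith
  have h2 : t / 2 ≤ sinh (t / 2) := self_le_sinh_iff.mpr (by linarith)
  have h3 : (t / 2) ^ 2 ≤ sinh (t / 2) ^ 2 := pow_le_pow_left₀ (by linarith) h2 2
  rw [h]; nlinarith

lemma self_le_cosh (t : ℝ) : t ≤ cosh t := by
  nlinarith [one_add_sq_le_cosh t, sq_nonneg (t - 1)]

lemma CoshBd.exp_bd {f : ℝ → ℝ} (hf : CoshBd f) {γ : ℝ} (hγ : 0 < γ) :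
    ∃ C, ∀ t, |exp (-γ * Real.cosh t) * f t| ≤ C * exp (-(γ / 2) * t) := by
  obtain ⟨hf, C, m, hC, h⟩ := hf
  refine ⟨C * (m.factorial * (2 / γ) ^ m), fun t => ?_⟩
  have hc := cosh_pos t
  have h1 := pow_div_factorial_le_exp (x := γ / 2 * Real.cosh t) (by positivity) m
  have h2 : Real.cosh t ^ m ≤ m.factorial * (2 / γ) ^ m * exp (γ / 2 * Real.cosh t) := by
    rw [div_le_iff₀ (by positivity)] at h1
    calc Real.cosh t ^ m = (2 / γ) ^ m * (γ / 2 * Real.cosh t) ^ m := by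
          rw [← mul_pow]; congr 1; field_simp
      _ ≤ (2 / γ) ^ m * (exp (γ / 2 * Real.cosh t) * m.factorial) := by gcongr
      _ = _ := by ring
  rw [abs_mul, abs_of_pos (exp_pos _)]
  calc exp (-γ * Real.cosh t) * |f t|
      ≤ exp (-γ * Real.cosh t) *
        (C * (m.factorial * (2 / γ) ^ m * exp (γ / 2 * Real.cosh t))) := by
        gcongr; exact (h t).trans (by gcongr)
    _ = C * (m.factorial * (2 / γ) ^ m) * exp (-(γ / 2) * Real.cosh t) := by
        rw [show -(γ / 2) * Real.cosh t = -γ * Real.cosh t + γ / 2 * Real.cosh t by ring, exp_add]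
        ring
    _ ≤ _ := by
        have := self_le_cosh t
        have h5 : -(γ / 2) * Real.cosh t ≤ -(γ / 2) * t := by nlinarith
        gcongr

lemma CoshBd.integrable {f : ℝ → ℝ} (hf : CoshBd f) {γ : ℝ} (hγ : 0 < γ) :
    IntegrableOn (fun t => exp (-γ * Real.cosh t) * f t) (Ioi 0) := by
  obtain ⟨C, h⟩ := hf.exp_bd hγ
  have hc := hf.1
  refine Integrable.mono' ((exp_neg_integrableOn_Ioi 0 (half_pos hγ)).const_mul C)
    (Continuous.aestronglyMeasurable (by fun_prop)) (ae_of_all _ h)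

lemma CoshBd.tendsto {f : ℝ → ℝ} (hf : CoshBd f) {γ : ℝ} (hγ : 0 < γ) :
    Tendsto (fun t => exp (-γ * Real.cosh t) * f t) atTop (nhds 0) := by
  obtain ⟨C, h⟩ := hf.exp_bd hγ
  refine squeeze_zero_norm h ?_
  rw [← mul_zero C]
  refine Tendsto.const_mul C (tendsto_exp_atBot.comp ?_)
  exact tendsto_id.const_mul_atTop_of_neg (by linarith)

lemma cosh_ibp {f f' : ℝ → ℝ} (hf : CoshBd f) (hf' : CoshBd f') (hd : ∀ t, HasDerivAt f (f' t) t)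
    (h0 : f 0 = 0) {γ : ℝ} (hγ : 0 < γ) :
    ∫ t in Ioi (0 : ℝ), exp (-γ * cosh t) * (f' t - γ * (sinh t * f t)) = 0 := by
  have hb : CoshBd (fun t => f' t - γ * (sinh t * f t)) :=
    hf'.sub ((CoshBd.const γ).mul (CoshBd.sinh.mul hf))
  have := integral_Ioi_of_hasDerivAt_of_tendsto' (f := fun t => exp (-γ * cosh t) * f t)
    (a := 0) (fun x _ => ?_) (hb.integrable hγ) (hf.tendsto hγ)
  · rw [this]; simp [h0]
  · have h1 := (((hasDerivAt_cosh x).const_mul (-γ)).exp).mul (hd x)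
    refine h1.congr_deriv ?_
    ring

lemma besselK_two_div {s : ℝ} (hs : 0 < s) :
    besselK 2 s / s = ∫ t in Ioi (0 : ℝ), exp (-s * cosh t) * (sinh t ^ 2 * cosh t) := by
  have h := cosh_ibp (f := fun t => sinh t * cosh t) (f' := fun t => cosh t ^ 2 + sinh t ^ 2)
    (CoshBd.sinh.mul CoshBd.cosh) ((CoshBd.cosh.pow 2).add (CoshBd.sinh.pow 2))
    (fun t => ((hasDerivAt_sinh t).mul (hasDerivAt_cosh t)).congr_deriv (by ring)) (by simp) hs
  have i1 := ((CoshBd.cosh.pow 2).add (CoshBd.sinh.pow 2)).integrable hs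
  have i2 := ((CoshBd.const s).mul ((CoshBd.sinh.pow 2).mul CoshBd.cosh)).integrable hs
  have e : ∀ t, exp (-s * cosh t) * (cosh t ^ 2 + sinh t ^ 2 - s * (sinh t * (sinh t * cosh t)))
    = exp (-s * cosh t) * (cosh t ^ 2 + sinh t ^ 2) -
      exp (-s * cosh t) * (s * (sinh t ^ 2 * cosh t)) := fun t => by ring
  simp only [e] at h
  rw [integral_sub i1 i2, sub_eq_zero] at h
  unfold besselK
  simp only [Nat.cast_ofNat, cosh_two_mul]
  rw [h, div_eq_iff hs.ne', ← integral_mul_const]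
  congr 1; ext t; ring

lemma besselK_num {s : ℝ} (hs : 0 < s) :
    besselK 3 s - besselK 2 s / s =
      ∫ t in Ioi (0 : ℝ), exp (-s * cosh t) * (3 * cosh t ^ 3 - 2 * cosh t) := by
  rw [besselK_two_div hs, besselK]
  simp only [Nat.cast_ofNat, cosh_three_mul]
  rw [← integral_sub]
  · congr 1; ext t; rw [sinh_sq]; ring
  · exact (((CoshBd.const 4).mul (CoshBd.cosh.pow 3)).sub
      ((CoshBd.const 3).mul CoshBd.cosh)).integrable hs
  · exact ((CoshBd.sinh.pow 2).mul CoshBd.cosh).integrable hs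

lemma integral_Ioi_shift (h : ℝ → ℝ) (γ : ℝ) :
    ∫ s in Ioi γ, h s = ∫ u in Ioi (0 : ℝ), h (u + γ) := by
  have := (measurePreserving_add_right (volume : Measure ℝ) γ).setIntegral_preimage_emb
    (measurableEmbedding_addRight γ) h (Ioi γ)
  rw [← this]
  simp

lemma inner_gamma {a : ℝ} (ha : -1 < a) (γ : ℝ) {c : ℝ} (hc : 0 < c) :
    ∫ s in Ioi γ, exp (-s * c) * (s - γ) ^ a = Gamma (a + 1) * (exp (-γ * c) * c ^ (-a - 1)) := by
  rw [integral_Ioi_shift]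
  have h := integral_rpow_mul_exp_neg_mul_Ioi (a := a + 1) (r := c) (by linarith) hc
  simp only [add_sub_cancel_right] at h ⊢
  have e : ∀ u, exp (-(u + γ) * c) * u ^ a = exp (-γ * c) * (u ^ a * exp (-(c * u))) := fun u => by
    rw [show -(u + γ) * c = -γ * c + -(c * u) by ring, exp_add]; ring
  simp only [e]
  rw [integral_const_mul, h, show -a - 1 = -(a + 1) by ring, rpow_neg hc.le, one_div,
    inv_rpow hc.le]
  ring

lemma inner_integrable {a : ℝ} (ha : -1 < a) (γ : ℝ) {c : ℝ} (hc : 0 < c) :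
    IntegrableOn (fun s => exp (-s * c) * (s - γ) ^ a) (Ioi γ) := by
  refine .of_integral_ne_zero ?_
  rw [inner_gamma ha γ hc]
  have := Gamma_pos_of_pos (show 0 < a + 1 by linarith)
  positivity

lemma fubini_step {a : ℝ} (ha : -1 < a) {γ : ℝ} (hγ : 0 < γ) {g : ℝ → ℝ} (hg : CoshBd g) :
    ∫ s in Ioi γ, (∫ t in Ioi (0 : ℝ), exp (-s * cosh t) * g t) * (s - γ) ^ a =
      Gamma (a + 1) * ∫ t in Ioi (0 : ℝ), exp (-γ * cosh t) * (g t * cosh t ^ (-a - 1)) := by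
  have hgc := hg.1
  have key : Integrable (Function.uncurry fun s t => exp (-s * cosh t) * g t * (s - γ) ^ a)
      ((volume.restrict (Ioi γ)).prod (volume.restrict (Ioi (0 : ℝ)))) := by
    rw [integrable_prod_iff']
    · simp only [Function.uncurry_apply_pair]
      constructor
      · refine ae_of_all _ fun t => ?_
        refine ((inner_integrable ha γ (cosh_pos t)).mul_const (g t)).congr (ae_of_all _ fun s => ?_)
        simp only; ring
      · have e : ∀ t, ∫ s in Ioi γ, ‖exp (-s * cosh t) * g t * (s - γ) ^ a‖ =
            Gamma (a + 1) * ‖exp (-γ * cosh t) * (g t * cosh t ^ (-a - 1))‖ := fun t => by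
          have hp := rpow_pos_of_pos (cosh_pos t) (-a - 1)
          rw [norm_mul, norm_mul, norm_of_nonneg hp.le, norm_of_nonneg (exp_pos _).le]
          have := inner_gamma ha γ (cosh_pos t)
          rw [show Gamma (a + 1) * (exp (-γ * cosh t) * (‖g t‖ * cosh t ^ (-a - 1))) =
            Gamma (a + 1) * (exp (-γ * cosh t) * cosh t ^ (-a - 1)) * ‖g t‖ by ring, ← this,
            ← integral_mul_const]
          refine setIntegral_congr_fun measurableSet_Ioi fun s hs => ?_
          have hs' : 0 ≤ (s - γ) ^ a := rpow_nonneg (sub_nonneg.mpr (le_of_lt hs)) _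
          simp only [norm_mul, norm_of_nonneg hs', norm_of_nonneg (exp_pos _).le]
          ring
        simp only [e]
        exact (((hg.mul (CoshBd.rpow (-a - 1))).integrable hγ).norm).const_mul _
    · refine Measurable.aestronglyMeasurable ?_
      have := hgc.measurable
      unfold Function.uncurry
      fun_prop
  simp only [← integral_mul_const]
  rw [integral_integral_swap key, ← integral_const_mul]
  congr 1; ext t
  have e : ∀ s, exp (-s * cosh t) * g t * (s - γ) ^ a =
    (exp (-s * cosh t) * (s - γ) ^ a) * g t := fun s => by ring
  simp only [e]
  rw [integral_mul_const, inner_gamma ha γ (cosh_pos t)]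
  ring

/-- The moment integrals. -/
noncomputable def coshM (p γ : ℝ) : ℝ :=
  ∫ t in Ioi (0 : ℝ), exp (-γ * cosh t) * (sinh t ^ 2 * cosh t ^ p)

lemma coshM_bd (p : ℝ) : CoshBd (fun t => sinh t ^ 2 * cosh t ^ p) :=
  (CoshBd.sinh.pow 2).mul (CoshBd.rpow p)

lemma coshM_hasDerivAt (p : ℝ) {γ : ℝ} (hγ : 0 < γ) :
    HasDerivAt (coshM p) (-coshM (p + 1) γ) γ := by
  have hb := coshM_bd p
  have hb1 := coshM_bd (p + 1)
  have hc := hb.1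
  have hc1 := hb1.1
  have := (hasDerivAt_integral_of_dominated_loc_of_deriv_le
    (μ := volume.restrict (Ioi (0 : ℝ))) (x₀ := γ) (s := Ioi (γ / 2))
    (F := fun γ t => exp (-γ * cosh t) * (sinh t ^ 2 * cosh t ^ p))
    (F' := fun γ t => -(exp (-γ * cosh t) * (sinh t ^ 2 * cosh t ^ (p + 1))))
    (bound := fun t => exp (-(γ / 2) * cosh t) * (sinh t ^ 2 * cosh t ^ (p + 1)))
    (Ioi_mem_nhds (by linarith)) ?_ (hb.integrable hγ) ?_ ?_ (hb1.integrable (half_pos hγ)) ?_).2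
  · simpa only [coshM, integral_neg] using! this
  · exact Eventually.of_forall fun x => Continuous.aestronglyMeasurable (by fun_prop)
  · exact Continuous.aestronglyMeasurable (by fun_prop)
  · refine ae_of_all _ fun t x hx => ?_
    have h1 := cosh_pos t
    have h2 := rpow_pos_of_pos h1 (p + 1)
    rw [norm_neg, norm_of_nonneg (by positivity)]
    have : -x * cosh t ≤ -(γ / 2) * cosh t := by
      have : γ / 2 < x := hx
      nlinarith
    gcongr
  · refine ae_of_all _ fun t x _ => ?_
    have h0 : HasDerivAt (fun y : ℝ => -y * cosh t) (-1 * cosh t) x :=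
      (hasDerivAt_neg x).mul_const (cosh t)
    have h1 := h0.exp.mul_const (sinh t ^ 2 * cosh t ^ p)
    refine h1.congr_deriv ?_
    rw [rpow_add_one (cosh_pos t).ne']
    ring

lemma coshM_pos (p : ℝ) {γ : ℝ} (hγ : 0 < γ) : 0 < coshM p γ := by
  unfold coshM
  have hpos : ∀ t ∈ Ioi (0 : ℝ), 0 < exp (-γ * cosh t) * (sinh t ^ 2 * cosh t ^ p) := fun t ht => by
    have := rpow_pos_of_pos (cosh_pos t) p
    have := sinh_pos_iff.mpr ht
    positivity
  rw [setIntegral_pos_iff_support_of_nonneg_ae _ ((coshM_bd p).integrable hγ)]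
  · have : Ioi (0 : ℝ) ⊆ Function.support
      (fun t => exp (-γ * cosh t) * (sinh t ^ 2 * cosh t ^ p)) ∩ Ioi 0 :=
      fun t ht => ⟨(hpos t ht).ne', ht⟩
    exact lt_of_lt_of_le (by simp) (measure_mono this)
  · exact (ae_restrict_iff' measurableSet_Ioi).mpr (ae_of_all _ fun t ht => (hpos t ht).le)

lemma rRatio_eq {a : ℝ} (ha : -1 < a) {γ : ℝ} (hγ : 0 < γ) :
    rRatio γ a = a + 1 + γ * (coshM (-a + 1) γ / coshM (-a) γ) := by
  have hG := Gamma_pos_of_pos (show 0 < a + 1 by linarith)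
  have hM := coshM_pos (-a) hγ
  have hD : (∫ s in Set.Ioi γ, (besselK 2 s / s) * (s - γ) ^ a) =
      Gamma (a + 1) * coshM (-a) γ := by
    rw [coshM]
    have e : ∀ t, sinh t ^ 2 * cosh t ^ (-a) = sinh t ^ 2 * cosh t * cosh t ^ (-a - 1) := fun t => by
      rw [rpow_sub_one (cosh_pos t).ne']
      have := (cosh_pos t).ne'
      field_simp
    simp only [e]
    rw [← fubini_step ha hγ ((CoshBd.sinh.pow 2).mul CoshBd.cosh)]
    refine setIntegral_congr_fun measurableSet_Ioi fun s hs => ?_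
    rw [besselK_two_div (lt_trans hγ hs)]
  have hN : (∫ s in Set.Ioi γ, (besselK 3 s - besselK 2 s / s) * (s - γ) ^ a) =
      Gamma (a + 1) * ((a + 1) * coshM (-a) γ + γ * coshM (-a + 1) γ) := by
    have hb : CoshBd (fun t => 3 * cosh t ^ 3 - 2 * cosh t) :=
      ((CoshBd.const 3).mul (CoshBd.cosh.pow 3)).sub ((CoshBd.const 2).mul CoshBd.cosh)
    have h1 : (∫ s in Set.Ioi γ, (besselK 3 s - besselK 2 s / s) * (s - γ) ^ a) =
      Gamma (a + 1) * ∫ t in Ioi (0 : ℝ), exp (-γ * cosh t) *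
        ((3 * cosh t ^ 3 - 2 * cosh t) * cosh t ^ (-a - 1)) := by
      rw [← fubini_step ha hγ hb]
      refine setIntegral_congr_fun measurableSet_Ioi fun s hs => ?_
      rw [besselK_num (lt_trans hγ hs)]
    rw [h1]
    congr 1
    have hI := cosh_ibp (f := fun t => sinh t * cosh t ^ (1 - a))
      (f' := fun t => cosh t * cosh t ^ (1 - a) + sinh t * (sinh t * (1 - a) * cosh t ^ (1 - a - 1)))
      (CoshBd.sinh.mul (CoshBd.rpow _))
      ((CoshBd.cosh.mul (CoshBd.rpow _)).add (CoshBd.sinh.mul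
        ((CoshBd.sinh.mul (CoshBd.const _)).mul (CoshBd.rpow _))))
      (fun t => (hasDerivAt_sinh t).mul ((hasDerivAt_cosh t).rpow_const (Or.inl (cosh_pos t).ne')))
      (by simp) hγ
    rw [← sub_eq_zero]
    refine Eq.trans ?_ hI
    unfold coshM
    rw [← integral_const_mul, ← integral_const_mul, ← integral_add, ← integral_sub]
    · congr 1; ext t
      have hc := cosh_pos t
      have e1 : cosh t ^ (-a) = cosh t ^ (-a - 1) * cosh t := by
        rw [← rpow_add_one hc.ne']; congr 1; ring
      have e2 : cosh t ^ (-a + 1) = cosh t ^ (-a - 1) * cosh t ^ 2 := by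
        rw [rpow_add_one hc.ne', e1]; ring
      have e3 : cosh t ^ (1 - a) = cosh t ^ (-a - 1) * cosh t ^ 2 := by
        rw [← e2]; congr 1; ring
      have e4 : cosh t ^ (1 - a - 1) = cosh t ^ (-a - 1) * cosh t := by
        rw [← e1]; congr 1; ring
      rw [e1, e2, e3, e4]
      simp only [mul_add, mul_sub]
      linear_combination (exp (-γ * cosh t) * cosh t ^ (-a - 1) * cosh t * 2) * (cosh_sq t)
    · exact (hb.mul (CoshBd.rpow (-a - 1))).integrable hγ
    · exact (((coshM_bd (-a)).integrable hγ).const_mul _).add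
        (((coshM_bd (-a + 1)).integrable hγ).const_mul _)
    · exact ((coshM_bd (-a)).integrable hγ).const_mul _
    · exact ((coshM_bd (-a + 1)).integrable hγ).const_mul _
  rw [rRatio, hN, hD]
  field_simp

lemma tendsto_sqrt_mul_sinh (w : ℝ) :
    Tendsto (fun γ : ℝ => √γ * sinh (w / √γ)) atTop (nhds w) := by
  have h1 : HasDerivAt (fun e : ℝ => sinh (w * e)) w 0 := by
    have := ((hasDerivAt_id (0 : ℝ)).const_mul w).sinh
    simpa using this
  have h2 := h1.tendsto_slope_zero
  have h3 : Tendsto (fun γ : ℝ => (√γ)⁻¹) atTop (nhdsWithin 0 {0}ᶜ) := by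
    have := tendsto_inv_atTop_nhdsGT_zero.comp tendsto_sqrt_atTop
    exact this.mono_right (nhdsWithin_mono _ fun x hx => ne_of_gt hx)
  refine (h2.comp h3).congr fun γ => ?_
  simp [div_eq_mul_inv]

/-- Rescaled moment integrand. -/
noncomputable def scaledF (b : ℝ) (k : ℕ) (γ v : ℝ) : ℝ :=
  exp (-(γ * (cosh (v / √γ) - 1))) * (γ * (cosh (v / √γ) - 1)) ^ k *
    (√γ * sinh (v / √γ)) ^ 2 * cosh (v / √γ) ^ b

lemma cosh_sub_one (x : ℝ) : cosh x - 1 = 2 * sinh (x / 2) ^ 2 := by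
  have := cosh_two_mul (x / 2)
  rw [cosh_sq, mul_div_cancel₀ x two_ne_zero] at this
  linarith

lemma scaledF_tendsto (b : ℝ) (k : ℕ) (v : ℝ) :
    Tendsto (fun γ => scaledF b k γ v) atTop
      (nhds (exp (-(v ^ 2 / 2)) * (v ^ 2 / 2) ^ k * v ^ 2)) := by
  have hy : Tendsto (fun γ : ℝ => γ * (cosh (v / √γ) - 1)) atTop (nhds (v ^ 2 / 2)) := by
    have h := ((tendsto_sqrt_mul_sinh (v / 2)).pow 2).const_mul 2
    rw [show 2 * (v / 2) ^ 2 = v ^ 2 / 2 by ring] at h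
    refine h.congr' ?_
    filter_upwards [eventually_ge_atTop 0] with γ hγ
    rw [cosh_sub_one, mul_pow, sq_sqrt hγ, show v / 2 / √γ = v / √γ / 2 by ring]
    ring
  have hc : Tendsto (fun γ : ℝ => cosh (v / √γ) ^ b) atTop (nhds 1) := by
    have h0 : Tendsto (fun γ : ℝ => v / √γ) atTop (nhds 0) :=
      tendsto_const_nhds.div_atTop tendsto_sqrt_atTop
    have h1 := ((CoshBd.rpow b).1.tendsto 0).comp h0
    simpa using! h1
  have := (((continuous_exp.tendsto _).comp hy.neg).mul (hy.pow k)).mul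
    ((tendsto_sqrt_mul_sinh v).pow 2) |>.mul hc
  simpa [scaledF] using! this

lemma sinh_le_mul_cosh {x : ℝ} (hx : 0 ≤ x) : sinh x ≤ x * cosh x := by
  have hm : MonotoneOn (fun x => x * cosh x - sinh x) (Ici 0) := by
    refine monotoneOn_of_deriv_nonneg (convex_Ici 0) (by fun_prop) (by fun_prop) fun y hy => ?_
    rw [interior_Ici] at hy
    have h : HasDerivAt (fun x => x * cosh x - sinh x) (y * sinh y) y :=
      (((hasDerivAt_id y).mul (hasDerivAt_cosh y)).sub (hasDerivAt_sinh y)).congr_deriv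
        (by simp)
    rw [h.deriv]
    exact mul_nonneg (le_of_lt hy) (sinh_nonneg_iff.mpr (le_of_lt hy))
  have := hm (self_mem_Ici) hx hx
  simp at this
  linarith

lemma cosh_le_exp_self {x : ℝ} (hx : 0 ≤ x) : cosh x ≤ exp x := by
  have := cosh_add_sinh x
  have := sinh_nonneg_iff.mpr hx
  linarith

lemma scaledF_bound (b : ℝ) (k : ℕ) : ∃ C, ∀ γ ≥ 1, ∀ v > 0,
    ‖scaledF b k γ v‖ ≤ C * exp (-1 * v) := by
  refine ⟨2 ^ k * k.factorial * (2 * exp ((4 + |b|) ^ 2)), fun γ hγ v hv => ?_⟩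
  have hs : 1 ≤ √γ := one_le_sqrt.mpr hγ
  have hs0 : 0 < √γ := by linarith
  set x := v / √γ with hx
  have hx0 : 0 < x := div_pos hv hs0
  have hxv : x ≤ v := div_le_self hv.le hs
  have hcx := cosh_pos x
  set y := γ * (cosh x - 1) with hy
  have hy1 : v ^ 2 / 2 ≤ y := by
    have h1 := one_add_sq_le_cosh x
    have h2 : x ^ 2 / 2 ≤ cosh x - 1 := by linarith
    calc v ^ 2 / 2 = γ * (x ^ 2 / 2) := by
          rw [hx, div_pow, sq_sqrt (by linarith)]; field_simp
      _ ≤ y := by rw [hy]; gcongr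
  have hy0 : 0 ≤ y := le_trans (by positivity) hy1
  have hA : exp (-y) * y ^ k ≤ 2 ^ k * k.factorial * exp (-(v ^ 2 / 4)) := by
    have h1 := pow_div_factorial_le_exp (x := y / 2) (by positivity) k
    rw [div_le_iff₀ (by positivity)] at h1
    calc exp (-y) * y ^ k = exp (-y) * (2 ^ k * (y / 2) ^ k) := by
          rw [← mul_pow]; congr 2; ring
      _ ≤ exp (-y) * (2 ^ k * (exp (y / 2) * k.factorial)) := by gcongr
      _ = 2 ^ k * k.factorial * exp (-(y / 2)) := by
          rw [show -(y / 2) = -y + y / 2 by ring, exp_add]; ring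
      _ ≤ _ := by
          have : -(y / 2) ≤ -(v ^ 2 / 4) := by linarith
          gcongr
  have hce : cosh x ≤ exp v := (cosh_le_exp_self hx0.le).trans (exp_le_exp.mpr hxv)
  have hB : (√γ * sinh x) ^ 2 ≤ 2 * exp (3 * v) := by
    have h1 : √γ * sinh x ≤ v * exp v := by
      calc √γ * sinh x ≤ √γ * (x * cosh x) := by gcongr; exact sinh_le_mul_cosh hx0.le
        _ = v * cosh x := by rw [hx]; field_simp
        _ ≤ _ := by gcongr
    have h2 : 0 ≤ √γ * sinh x := mul_nonneg hs0.le (sinh_nonneg_iff.mpr hx0.le)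
    have h3 := pow_div_factorial_le_exp (x := v) hv.le 2
    simp only [Nat.factorial_two, Nat.cast_ofNat] at h3
    calc (√γ * sinh x) ^ 2 ≤ (v * exp v) ^ 2 := by gcongr
      _ = v ^ 2 * exp v ^ 2 := by ring
      _ ≤ (2 * exp v) * exp v ^ 2 := by gcongr; linarith
      _ = 2 * exp (3 * v) := by
        rw [show 3 * v = v + v + v by ring, exp_add, exp_add]; ring
  have hC : cosh x ^ b ≤ exp (|b| * v) := by
    calc cosh x ^ b ≤ cosh x ^ |b| := rpow_le_rpow_of_exponent_le (one_le_cosh x) (le_abs_self b)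
      _ ≤ exp v ^ |b| := rpow_le_rpow hcx.le hce (abs_nonneg b)
      _ = exp (|b| * v) := by rw [← exp_mul]; congr 1; ring
  have hcp := rpow_pos_of_pos hcx b
  have : scaledF b k γ v = exp (-y) * y ^ k * (√γ * sinh x) ^ 2 * cosh x ^ b := rfl
  rw [this, norm_of_nonneg (by positivity)]
  calc exp (-y) * y ^ k * (√γ * sinh x) ^ 2 * cosh x ^ b
      ≤ 2 ^ k * k.factorial * exp (-(v ^ 2 / 4)) * (2 * exp (3 * v)) * exp (|b| * v) := by gcongr
    _ = 2 ^ k * k.factorial * (2 * exp (-(v ^ 2 / 4) + 3 * v + |b| * v)) := by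
        rw [exp_add, exp_add]; ring
    _ ≤ 2 ^ k * k.factorial * (2 * exp ((4 + |b|) ^ 2 + -1 * v)) := by
        have : -(v ^ 2 / 4) + 3 * v + |b| * v ≤ (4 + |b|) ^ 2 + -1 * v := by
          nlinarith [sq_nonneg (v / 2 - (4 + |b|))]
        gcongr
    _ = _ := by rw [exp_add]; ring

lemma scaledF_integral_tendsto (b : ℝ) (k : ℕ) :
    Tendsto (fun γ => ∫ v in Ioi (0 : ℝ), scaledF b k γ v) atTop
      (nhds (∫ v in Ioi (0 : ℝ), exp (-(v ^ 2 / 2)) * (v ^ 2 / 2) ^ k * v ^ 2)) := by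
  obtain ⟨C, hC⟩ := scaledF_bound b k
  refine tendsto_integral_filter_of_dominated_convergence (fun v => C * exp (-1 * v)) ?_ ?_
    ((exp_neg_integrableOn_Ioi 0 one_pos).const_mul C) (ae_of_all _ fun v => scaledF_tendsto b k v)
  · refine Eventually.of_forall fun γ => Measurable.aestronglyMeasurable ?_
    unfold scaledF
    fun_prop
  · filter_upwards [eventually_ge_atTop 1] with γ hγ
    exact (ae_restrict_iff' measurableSet_Ioi).mpr (ae_of_all _ fun v hv => hC γ hγ v hv)

lemma gauss_moment (k : ℕ) :
    ∫ v in Ioi (0 : ℝ), exp (-(v ^ 2 / 2)) * (v ^ 2 / 2) ^ k * v ^ 2 = √2 * Gamma (k + 3 / 2) := by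
  have h := integral_rpow_mul_exp_neg_mul_rpow (p := 2) (q := 2 * k + 2) (b := 1 / 2) (by norm_num)
    (by have : (0 : ℝ) ≤ k := k.cast_nonneg
        linarith) (by norm_num)
  have e : ∫ v in Ioi (0 : ℝ), exp (-(v ^ 2 / 2)) * (v ^ 2 / 2) ^ k * v ^ 2 =
      (1 / 2) ^ k * ∫ v in Ioi (0 : ℝ), v ^ (2 * k + 2 : ℝ) * exp (-(1 / 2) * v ^ (2 : ℝ)) := by
    rw [← integral_const_mul]
    refine setIntegral_congr_fun measurableSet_Ioi fun v hv => ?_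
    have e1 : v ^ (2 * k + 2 : ℝ) = (v ^ 2) ^ k * v ^ 2 := by
      rw [← pow_mul, ← pow_add, ← rpow_natCast]; push_cast; rfl
    rw [e1, rpow_two, show -(1 / 2) * v ^ 2 = -(v ^ 2 / 2) by ring, div_pow, div_pow]
    ring
  rw [e, h, show (2 * (k : ℝ) + 2 + 1) / 2 = k + 3 / 2 by ring,
    show -(2 * (k : ℝ) + 2 + 1) / 2 = -(k : ℝ) + (-1) + (-(1 / 2)) by ring,
    rpow_add (by norm_num), rpow_add (by norm_num), rpow_neg (by norm_num), rpow_natCast,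
    rpow_neg_one, rpow_neg (by norm_num), ← sqrt_eq_rpow, one_div, sqrt_inv]
  have : (2 : ℝ)⁻¹ ^ k ≠ 0 := by positivity
  field_simp

lemma scaledF_integral_eq (b : ℝ) (k : ℕ) {γ : ℝ} (hγ : 0 < γ) :
    ∫ v in Ioi (0 : ℝ), scaledF b k γ v = γ * √γ * exp γ *
      ∫ t in Ioi (0 : ℝ), exp (-γ * cosh t) * ((γ * (cosh t - 1)) ^ k * (sinh t ^ 2 * cosh t ^ b)) := by
  have hs : 0 < √γ := sqrt_pos.mpr hγ
  have h := integral_comp_mul_left_Ioi (fun t => γ * exp γ * (exp (-γ * cosh t) *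
    ((γ * (cosh t - 1)) ^ k * (sinh t ^ 2 * cosh t ^ b)))) 0 (inv_pos.mpr hs)
  rw [mul_zero, inv_inv, smul_eq_mul] at h
  calc _ = √γ * (γ * exp γ * ∫ t in Ioi (0 : ℝ), exp (-γ * cosh t) *
        ((γ * (cosh t - 1)) ^ k * (sinh t ^ 2 * cosh t ^ b))) := by
        rw [← integral_const_mul, ← h]
        congr 1; ext v
        rw [scaledF, ← div_eq_inv_mul, mul_pow √γ, sq_sqrt hγ.le,
          show -(γ * (cosh (v / √γ) - 1)) = γ + -γ * cosh (v / √γ) by ring, exp_add]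
        ring
    _ = _ := by ring

lemma variance_eq (b : ℝ) {γ : ℝ} (hγ : 0 < γ) :
    γ ^ 2 * ((coshM (b + 1 + 1) γ * coshM b γ - coshM (b + 1) γ ^ 2) / coshM b γ ^ 2) =
      (∫ v in Ioi (0 : ℝ), scaledF b 2 γ v) / (∫ v in Ioi (0 : ℝ), scaledF b 0 γ v) -
      ((∫ v in Ioi (0 : ℝ), scaledF b 1 γ v) / (∫ v in Ioi (0 : ℝ), scaledF b 0 γ v)) ^ 2 := by
  have i0 := (coshM_bd b).integrable hγ
  have i1 := (coshM_bd (b + 1)).integrable hγ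
  have i2 := (coshM_bd (b + 1 + 1)).integrable hγ
  have h0 : ∫ t in Ioi (0 : ℝ), exp (-γ * cosh t) *
      ((γ * (cosh t - 1)) ^ 0 * (sinh t ^ 2 * cosh t ^ b)) = coshM b γ := by
    simp [coshM]
  have h1 : ∫ t in Ioi (0 : ℝ), exp (-γ * cosh t) *
      ((γ * (cosh t - 1)) ^ 1 * (sinh t ^ 2 * cosh t ^ b)) =
      γ * (coshM (b + 1) γ - coshM b γ) := by
    unfold coshM
    rw [← integral_sub i1 i0, ← integral_const_mul]
    congr 1; ext t
    rw [rpow_add_one (cosh_pos t).ne']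
    ring
  have h2 : ∫ t in Ioi (0 : ℝ), exp (-γ * cosh t) *
      ((γ * (cosh t - 1)) ^ 2 * (sinh t ^ 2 * cosh t ^ b)) =
      γ ^ 2 * (coshM (b + 1 + 1) γ - 2 * coshM (b + 1) γ + coshM b γ) := by
    unfold coshM
    have i3 : IntegrableOn (fun t => exp (-γ * cosh t) * (sinh t ^ 2 * cosh t ^ (b + 1 + 1)) -
      2 * (exp (-γ * cosh t) * (sinh t ^ 2 * cosh t ^ (b + 1)))) (Ioi 0) :=
      i2.sub (i1.const_mul 2)
    rw [← integral_const_mul 2, ← integral_sub i2 (i1.const_mul 2),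
      ← integral_add i3 i0, ← integral_const_mul]
    congr 1; ext t
    rw [rpow_add_one (cosh_pos t).ne', rpow_add_one (cosh_pos t).ne']
    ring
  rw [scaledF_integral_eq b 0 hγ, scaledF_integral_eq b 1 hγ, scaledF_integral_eq b 2 hγ, h0, h1, h2]
  have hM := coshM_pos b hγ
  have hs : 0 < √γ := sqrt_pos.mpr hγ
  have he := exp_pos γ
  rw [mul_div_mul_left _ _ (by positivity), mul_div_mul_left _ _ (by positivity)]
  field_simp
  ring

lemma variance_tendsto (b : ℝ) :
    Tendsto (fun γ => γ ^ 2 *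
      ((coshM (b + 1 + 1) γ * coshM b γ - coshM (b + 1) γ ^ 2) / coshM b γ ^ 2))
      atTop (nhds (3 / 2)) := by
  have t0 := scaledF_integral_tendsto b 0
  have t1 := scaledF_integral_tendsto b 1
  have t2 := scaledF_integral_tendsto b 2
  rw [gauss_moment] at t0 t1 t2
  have hG : 0 < Gamma (3 / 2) := Gamma_pos_of_pos (by norm_num)
  have g1 : Gamma (5 / 2) = 3 / 2 * Gamma (3 / 2) := by
    rw [← Gamma_add_one (by norm_num)]; norm_num
  have g2 : Gamma (7 / 2) = 5 / 2 * Gamma (5 / 2) := by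
    rw [← Gamma_add_one (by norm_num)]; norm_num
  have hne : √2 * Gamma ((0 : ℕ) + 3 / 2) ≠ 0 := by
    simp [hG.ne']
  have T := (t2.div t0 hne).sub ((t1.div t0 hne).pow 2)
  have hlim : √2 * Gamma ((2 : ℕ) + 3 / 2) / (√2 * Gamma ((0 : ℕ) + 3 / 2)) -
      (√2 * Gamma ((1 : ℕ) + 3 / 2) / (√2 * Gamma ((0 : ℕ) + 3 / 2))) ^ 2 = 3 / 2 := by
    rw [show ((2 : ℕ) : ℝ) + 3 / 2 = 7 / 2 by norm_num, show ((1 : ℕ) : ℝ) + 3 / 2 = 5 / 2 by norm_num,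
      show ((0 : ℕ) : ℝ) + 3 / 2 = 3 / 2 by norm_num, g2, g1]
    field_simp
    norm_num
  rw [hlim] at T
  refine T.congr' ?_
  filter_upwards [eventually_gt_atTop 0] with γ hγ
  exact (variance_eq b hγ).symm

lemma rRatio_hasDerivAt {a : ℝ} (ha : -1 < a) {γ : ℝ} (hγ : 0 < γ) :
    HasDerivAt (fun γ => rRatio γ a)
      (coshM (-a + 1) γ / coshM (-a) γ - γ *
        ((coshM (-a + 1 + 1) γ * coshM (-a) γ - coshM (-a + 1) γ ^ 2) / coshM (-a) γ ^ 2)) γ := by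
  have hM := (coshM_pos (-a) hγ).ne'
  have h := ((hasDerivAt_id γ).mul ((coshM_hasDerivAt (-a + 1) hγ).div
    (coshM_hasDerivAt (-a) hγ) hM)).const_add (a + 1)
  refine (h.congr_of_eventuallyEq ?_).congr_deriv ?_
  · filter_upwards [Ioi_mem_nhds hγ] with x hx
    exact rRatio_eq ha hx
  · simp only [id, Pi.div_apply]
    ring

/-- For `a > -1`, `γ ↦ r(γ, a)` is differentiable on `(0, ∞)` and the dimensionless
specific heat `ĉ_V(γ) = r(γ, a) - γ ∂r/∂γ(γ, a)` tends to the polyatomic value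
`a + 5/2 = D/2` in the classical limit `γ → ∞`. -/
theorem specific_heat_classical_limit (a : ℝ) (ha : -1 < a) :
    (∀ γ : ℝ, 0 < γ → DifferentiableAt ℝ (fun γ : ℝ => rRatio γ a) γ) ∧
    Filter.Tendsto
      (fun γ : ℝ => rRatio γ a - γ * deriv (fun γ : ℝ => rRatio γ a) γ)
      Filter.atTop (nhds (a + 5 / 2)) := by

  refine ⟨fun γ hγ => (rRatio_hasDerivAt ha hγ).differentiableAt, ?_⟩
  have T := (variance_tendsto (-a)).const_add (a + 1)
  rw [show a + 1 + 3 / 2 = a + 5 / 2 by ring] at T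
  refine T.congr' ?_
  filter_upwards [eventually_gt_atTop 0] with γ hγ
  rw [(rRatio_hasDerivAt ha hγ).deriv, rRatio_eq ha hγ]
  ring
end
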